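/- arXiv:1807.01199 — 6 statements merged into one kernel-verified Lean document; each statement's English description precedes it below -/
import Mathlib

section
/- Under the Setup, for every positive integer n there exist an open neighborhood W ⊆ N of x with W ∩ (−W) = ∅ and a C^∞ function g : W → ℝ such that: (i) g(p) > 0 for all p ∈ W; (ii) g is ℝ-homogeneous of degree n, i.e. g(t·p) = t^n·g(p) whenever p ∈ W, t ∈ ℝ and t·p ∈ W; (iii) for every p ∈ W and every c ∈ ℂ, the real Fréchet derivative of g at p annihilates c·𝒱(p) (that is, g is constant along the leaves of the foliation by complex curves induced by 𝒱 via the Frobenius theorem). -/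
open scoped ContDiff

section

variable {K E F : Type} [TopologicalSpace K] [CompactSpace K]
  [NormedAddCommGroup E] [NormedSpace ℝ E] [NormedAddCommGroup F] [NormedSpace ℝ F]

/-- Pointwise application of a continuous family of operators to a continuous function. -/
noncomputable def ContinuousMap.pointwiseApply :
    C(K, E →L[ℝ] F) →L[ℝ] C(K, E) →L[ℝ] C(K, F) :=
  LinearMap.mkContinuous₂
    (LinearMap.mk₂ ℝ (fun (A : C(K, E →L[ℝ] F)) (γ : C(K, E)) =>
        (⟨fun t => A t (γ t), A.continuous.clm_apply γ.continuous⟩ : C(K, F)))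
      (fun _ _ _ => by ext; simp) (fun _ _ _ => by ext; simp)
      (fun _ _ _ => by ext; simp) (fun _ _ _ => by ext; simp)) 1 (by
    intro A γ
    rw [one_mul, ContinuousMap.norm_le _ (by positivity)]
    intro t
    exact (A t).le_of_opNorm_le_of_le (A.norm_coe_le_norm t) (γ.norm_coe_le_norm t))

@[simp]
theorem ContinuousMap.pointwiseApply_apply (A : C(K, E →L[ℝ] F)) (γ : C(K, E)) (t : K) :
    ContinuousMap.pointwiseApply A γ t = A t (γ t) := rfl

theorem ContinuousMap.hasFDerivAt_postcomp {f : C(E, F)} {f' : C(E, E →L[ℝ] F)}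
    (hf : ∀ x, HasFDerivAt f (f' x) x) (γ : C(K, E)) :
    HasFDerivAt (fun γ : C(K, E) => f.comp γ) (ContinuousMap.pointwiseApply (f'.comp γ)) γ := by
  rw [hasFDerivAt_iff_isLittleO, Asymptotics.isLittleO_iff]
  intro ε hε
  have hc : Continuous fun γ : C(K, E) => f'.comp γ := ContinuousMap.continuous_postcomp f'
  obtain ⟨r, hr, H⟩ := (Metric.continuousAt_iff (α := C(K, E)) (β := C(K, E →L[ℝ] F))).1
    (hc.continuousAt (x := γ)) ε hε
  filter_upwards [Metric.ball_mem_nhds γ hr] with γ' hγ'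
  rw [ContinuousMap.norm_le _ (by positivity)]
  intro t
  have key := (convex_segment (γ t) (γ' t)).norm_image_sub_le_of_norm_hasFDerivWithin_le'
    (f := f) (f' := f') (φ := f' (γ t)) (C := ε) (fun y _ => (hf y).hasFDerivWithinAt) ?_
    (left_mem_segment ℝ _ _) (right_mem_segment ℝ _ _)
  · refine key.trans ?_
    gcongr
    exact (γ' - γ).norm_coe_le_norm t
  · intro y hy
    rw [segment_eq_image_lineMap] at hy
    obtain ⟨θ, hθ, rfl⟩ := hy
    have hmem : AffineMap.lineMap γ γ' θ ∈ Metric.ball γ r :=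
      (convex_ball γ r).segment_subset (Metric.mem_ball_self hr) hγ'
        (segment_eq_image_lineMap ℝ γ γ' ▸ ⟨θ, hθ, rfl⟩)
    have := (ContinuousMap.dist_apply_le_dist t).trans_lt (H hmem)
    rw [dist_eq_norm] at this
    simpa [AffineMap.lineMap_apply] using this.le

end

theorem ContinuousMap.contDiff_postcomp_nat {K : Type} [TopologicalSpace K] [CompactSpace K]
    {E : Type} [NormedAddCommGroup E] [NormedSpace ℝ E] (n : ℕ) :
    ∀ {F : Type} [NormedAddCommGroup F] [NormedSpace ℝ F] (f : C(E, F)), ContDiff ℝ n f →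
      ContDiff ℝ n (fun γ : C(K, E) => f.comp γ) := by
  induction n with
  | zero =>
    intro F _ _ f _
    exact contDiff_zero.2 (ContinuousMap.continuous_postcomp f)
  | succ n ih =>
    intro F _ _ f hf
    push_cast at hf ⊢
    obtain ⟨-, h2, h3⟩ := contDiff_succ_iff_fderiv.1 hf
    rw [contDiff_succ_iff_hasFDerivAt]
    exact ⟨_, ContinuousMap.pointwiseApply.contDiff.comp (ih ⟨fderiv ℝ f, h3.continuous⟩ h3),
      ContinuousMap.hasFDerivAt_postcomp
        fun x => ((hf.differentiable (by simp)) x).hasFDerivAt⟩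

theorem ContinuousMap.contDiff_postcomp {K : Type} [TopologicalSpace K] [CompactSpace K]
    {E F : Type} [NormedAddCommGroup E] [NormedSpace ℝ E] [NormedAddCommGroup F] [NormedSpace ℝ F]
    (f : C(E, F)) (hf : ContDiff ℝ ∞ f) : ContDiff ℝ ∞ (fun γ : C(K, E) => f.comp γ) :=
  contDiff_infty.2 fun n => contDiff_postcomp_nat n f (contDiff_infty.1 hf n)

theorem ContDiffOn.exists_openPartialHomeomorph {E F : Type*}
    [NormedAddCommGroup E] [NormedSpace ℝ E] [CompleteSpace E]
    [NormedAddCommGroup F] [NormedSpace ℝ F] {f : E → F} {U : Set E} (hU : IsOpen U)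
    (hf : ContDiffOn ℝ ∞ f U) {a : E} (ha : a ∈ U) {f' : E ≃L[ℝ] F}
    (hf' : HasFDerivAt f (f' : E →L[ℝ] F) a) :
    ∃ e : OpenPartialHomeomorph E F, (e : E → F) = f ∧ a ∈ e.source ∧ e.source ⊆ U ∧
      ContDiffOn ℝ ∞ e.symm e.target ∧
      ∀ p ∈ e.source, ∃ A : E ≃L[ℝ] F, HasFDerivAt f (A : E →L[ℝ] F) p ∧
        HasFDerivAt e.symm (A.symm : F →L[ℝ] E) (f p) := by
  have hfa : ContDiffAt ℝ ∞ f a := hf.contDiffAt (hU.mem_nhds ha)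
  have hcont : ContinuousOn (fderiv ℝ f) U := hf.continuousOn_fderiv_of_isOpen hU (by simp)
  have hO : IsOpen (U ∩ fderiv ℝ f ⁻¹' Set.range ((↑) : (E ≃L[ℝ] F) → E →L[ℝ] F)) :=
    hcont.isOpen_inter_preimage hU ContinuousLinearEquiv.isOpen
  have haO : a ∈ U ∩ fderiv ℝ f ⁻¹' Set.range ((↑) : (E ≃L[ℝ] F) → E →L[ℝ] F) :=
    ⟨ha, f', hf'.fderiv.symm⟩
  let e := (hfa.toOpenPartialHomeomorph f hf' (by simp)).restrOpen _ hO
  have hsrc : ∀ p ∈ e.source, p ∈ U ∧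
      ∃ A : E ≃L[ℝ] F, HasFDerivAt f (A : E →L[ℝ] F) p := by
    rintro p ⟨-, hp, A, hA⟩
    refine ⟨hp, A, ?_⟩
    rw [hA]
    exact ((hf.contDiffAt (hU.mem_nhds hp)).differentiableAt (by simp)).hasFDerivAt
  refine ⟨e, rfl, ⟨hfa.mem_toOpenPartialHomeomorph_source hf' (by simp), haO⟩,
    fun p hp => (hsrc p hp).1, ?_, ?_⟩
  · intro q hq
    obtain ⟨hpU, A, hA⟩ := hsrc _ (e.map_target hq)
    exact (e.contDiffAt_symm hq hA (hf.contDiffAt (hU.mem_nhds hpU))).contDiffWithinAt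
  · intro p hp
    obtain ⟨hpU, A, hA⟩ := hsrc p hp
    refine ⟨A, hA, ?_⟩
    refine e.hasFDerivAt_symm (e.map_source hp) ?_
    rw [show e.symm (f p) = p from e.left_inv hp]
    exact hA

/-- The primitive vanishing at `0` of a continuous function on the unit interval. -/
noncomputable def unitInterval.primitive (E : Type) [NormedAddCommGroup E] [NormedSpace ℝ E] :
    C(unitInterval, E) →L[ℝ] C(unitInterval, E) :=
  LinearMap.mkContinuous
    { toFun := fun γ => ⟨fun t => ∫ s in (0 : ℝ)..t, Set.IccExtend zero_le_one γ s,
        (intervalIntegral.continuous_primitive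
          (fun a b => γ.continuous.Icc_extend'.intervalIntegrable a b) 0).comp
          continuous_subtype_val⟩
      map_add' := fun γ δ => by
        ext t
        exact intervalIntegral.integral_add (γ.continuous.Icc_extend'.intervalIntegrable _ _)
          (δ.continuous.Icc_extend'.intervalIntegrable _ _)
      map_smul' := fun c γ => by
        ext t
        exact intervalIntegral.integral_smul c _ } 1 (by
    intro γ
    rw [one_mul, ContinuousMap.norm_le _ (norm_nonneg _)]
    intro t
    refine (intervalIntegral.norm_integral_le_of_norm_le_const (C := ‖γ‖)
      fun s _ => γ.norm_coe_le_norm _).trans ?_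
    rw [sub_zero, abs_of_nonneg t.2.1]
    exact mul_le_of_le_one_right (norm_nonneg _) t.2.2)

theorem unitInterval.primitive_apply {E : Type} [NormedAddCommGroup E] [NormedSpace ℝ E]
    (γ : C(unitInterval, E)) (t : unitInterval) :
    unitInterval.primitive E γ t = ∫ s in (0 : ℝ)..t, Set.IccExtend zero_le_one γ s := rfl

section
variable {E : Type} [NormedAddCommGroup E] [NormedSpace ℝ E] [NormedSpace ℂ E]
  [IsScalarTower ℝ ℂ E]

/-- The map whose fibres are the complex-time integral curves of `X`: `γ` satisfies
`γ' = ζ • X γ` and `γ 0 = q` iff the image of `(ζ, γ)` is `(ζ, const q)`. -/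
noncomputable def curveMap (X : C(E, E)) (z : ℂ × C(unitInterval, E)) : ℂ × C(unitInterval, E) :=
  (z.1, z.2 - z.1 • unitInterval.primitive E (X.comp z.2))

theorem contDiff_curveMap (X : C(E, E)) (hX : ContDiff ℝ ∞ X) : ContDiff ℝ ∞ (curveMap X) :=
  contDiff_fst.prodMk <| contDiff_snd.sub <| contDiff_fst.smul <|
    (unitInterval.primitive E).contDiff.comp
      ((ContinuousMap.contDiff_postcomp X hX).comp contDiff_snd)

theorem hasFDerivAt_curveMap (X : C(E, E)) (hX : ContDiff ℝ ∞ X)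
    (z : ℂ × C(unitInterval, E)) : ∃ L : ℂ × C(unitInterval, E) →L[ℝ] ℂ × C(unitInterval, E),
      HasFDerivAt (curveMap X) L z ∧ ∀ c J, L (c, J) = (c, J -
        (z.1 • unitInterval.primitive E (ContinuousMap.pointwiseApply
            ((⟨fderiv ℝ X, hX.continuous_fderiv (by simp)⟩ : C(E, E →L[ℝ] E)).comp z.2) J)
          + c • unitInterval.primitive E (X.comp z.2))) := by
  have h1 := (ContinuousMap.hasFDerivAt_postcomp (K := unitInterval)
    (f' := ⟨fderiv ℝ X, hX.continuous_fderiv (by simp)⟩)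
    (fun x => ((hX.differentiable (by simp)) x).hasFDerivAt) z.2)
  have h2 := (unitInterval.primitive E).hasFDerivAt.comp z (h1.comp z hasFDerivAt_snd)
  have h3 := (hasFDerivAt_fst (𝕜 := ℝ) (p := z)).prodMk
    ((hasFDerivAt_snd (𝕜 := ℝ) (p := z)).sub ((hasFDerivAt_fst (𝕜 := ℝ) (p := z)).smul h2))
  exact ⟨_, h3, fun c J => rfl⟩

theorem primitive_variation [CompleteSpace E] (X : C(E, E)) (hX : ContDiff ℝ ∞ X) (ζ c : ℂ) (q : E)
    (γ : C(unitInterval, E))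
    (hγ : ∀ t, γ t = q + ζ • unitInterval.primitive E (X.comp γ) t)
    (hlin : ∀ t, ∀ c : ℂ, fderiv ℝ X (γ t) (c • X (γ t)) = c • fderiv ℝ X (γ t) (X (γ t)))
    (J : C(unitInterval, E)) (hJ : ∀ t, J t = ((t : ℝ) * c) • X (γ t)) :
    ζ • unitInterval.primitive E (ContinuousMap.pointwiseApply
        ((⟨fderiv ℝ X, hX.continuous_fderiv (by simp)⟩ : C(E, E →L[ℝ] E)).comp γ) J)
      + c • unitInterval.primitive E (X.comp γ) = J := by
  set y : ℝ → E := Set.IccExtend zero_le_one γ with hy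
  have hyc : Continuous y := γ.continuous.Icc_extend'
  have hyγ : ∀ t : unitInterval, y t = γ t := fun t => by simp [hy]
  have hderiv : ∀ s ∈ Set.Ioo (0 : ℝ) 1, HasDerivAt y (ζ • X (y s)) s := by
    intro s hs
    have hF : Continuous fun s => X (y s) := X.continuous.comp hyc
    have h := ((intervalIntegral.integral_hasDerivAt_right (hF.intervalIntegrable 0 s)
      hF.stronglyMeasurable.stronglyMeasurableAtFilter hF.continuousAt).const_smul ζ).const_add q
    refine h.congr_of_eventuallyEq ?_
    filter_upwards [Icc_mem_nhds hs.1 hs.2] with r hr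
    have := hγ ⟨r, hr⟩
    rw [← hyγ, unitInterval.primitive_apply] at this
    exact this
  have hXd : ∀ p, HasFDerivAt X (fderiv ℝ X p) p :=
    fun p => ((hX.differentiable (by simp)) p).hasFDerivAt
  have hDc : Continuous (fderiv ℝ X) := hX.continuous_fderiv (by simp)
  have hg : ∀ s ∈ Set.Ioo (0 : ℝ) 1, HasDerivAt (fun s : ℝ => ((s : ℂ) * c) • X (y s))
      (ζ • fderiv ℝ X (y s) (((s : ℂ) * c) • X (y s)) + c • X (y s)) s := by
    intro s hs
    have h1 : HasDerivAt (fun s : ℝ => (s : ℂ) * c) c s := by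
      simpa using (Complex.ofRealCLM.hasDerivAt (x := s)).mul_const c
    have h2 := h1.smul ((hXd (y s)).comp_hasDerivAt s (hderiv s hs))
    have h3 := hlin ⟨s, Set.Ioo_subset_Icc_self hs⟩
    rw [← hyγ] at h3
    simp only at h3
    refine h2.congr_deriv ?_
    simp only [Function.comp_apply]
    rw [h3, h3, smul_smul, smul_smul, mul_comm ζ]
  ext t
  have hint1 : Continuous fun s : ℝ => ζ • fderiv ℝ X (y s) (((s : ℂ) * c) • X (y s)) :=
    ((hDc.comp hyc).clm_apply ((Complex.continuous_ofReal.mul continuous_const).smul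
      (X.continuous.comp hyc))).const_smul ζ
  have hint2 : Continuous fun s : ℝ => c • X (y s) := (X.continuous.comp hyc).const_smul c
  have key := intervalIntegral.integral_eq_sub_of_hasDerivAt_of_le (a := 0) (b := t)
    (f := fun s : ℝ => ((s : ℂ) * c) • X (y s)) t.2.1
    ((Complex.continuous_ofReal.mul continuous_const).smul
      (X.continuous.comp hyc)).continuousOn
    (fun s hs => hg s ⟨hs.1, hs.2.trans_le t.2.2⟩)
    ((hint1.add hint2).intervalIntegrable _ _)
  rw [intervalIntegral.integral_add (hint1.intervalIntegrable _ _)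
    (hint2.intervalIntegrable _ _), intervalIntegral.integral_smul,
    intervalIntegral.integral_smul] at key
  rw [hJ, ← hyγ]
  simp only [ContinuousMap.add_apply, ContinuousMap.smul_apply, unitInterval.primitive_apply]
  simp only [Complex.ofReal_zero, zero_mul, zero_smul, sub_zero] at key
  rw [← key]
  congr 2
  refine intervalIntegral.integral_congr fun s hs => ?_
  rw [Set.uIcc_of_le t.2.1] at hs
  have hs' : s ∈ Set.Icc (0 : ℝ) 1 := ⟨hs.1, hs.2.trans t.2.2⟩
  have hys : y s = γ ⟨s, hs'⟩ := hyγ ⟨s, hs'⟩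
  simp only [Set.IccExtend_of_mem _ _ hs', ContinuousMap.pointwiseApply_apply, hJ, hys]
  rfl

theorem exists_smooth_complex_flow [CompleteSpace E] (X : C(E, E)) (hX : ContDiff ℝ ∞ X) {B : Set E}
    (hB : IsOpen B) {x : E} (hx : x ∈ B)
    (hlin : ∀ p ∈ B, ∀ c : ℂ, fderiv ℝ X p (c • X p) = c • fderiv ℝ X p (X p)) :
    ∃ (U : Set (ℂ × E)) (Γ : ℂ × E → E), IsOpen U ∧ (0, x) ∈ U ∧ ContDiffOn ℝ ∞ Γ U ∧
      ∀ z ∈ U, Γ z ∈ B ∧ (z.1 = 0 → Γ z = z.2) ∧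
        ∀ c : ℂ, fderiv ℝ Γ z (c, 0) = c • X (Γ z) := by
  let C := C(unitInterval, E)
  let U₀ : Set (ℂ × C) := {z | ∀ t, z.2 t ∈ B}
  have hU₀ : IsOpen U₀ := by
    have := (ContinuousMap.isOpen_setOfPred_mapsTo (X := unitInterval) isCompact_univ hB).preimage
      (continuous_snd (X := ℂ))
    convert this using 1
    exact Set.ext fun z => ⟨fun h t _ => h t, fun h t => h (Set.mem_univ t)⟩
  let x₀ : ℂ × C := (0, ContinuousMap.const _ x)
  obtain ⟨L, hL, hLapp⟩ := hasFDerivAt_curveMap X hX x₀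
  let κ : C := unitInterval.primitive E (X.comp x₀.2)
  let L' : ℂ × C →L[ℝ] ℂ × C := (ContinuousLinearMap.fst ℝ ℂ C).prod
    (ContinuousLinearMap.snd ℝ ℂ C + (ContinuousLinearMap.fst ℝ ℂ C).smulRight κ)
  let A : (ℂ × C) ≃L[ℝ] ℂ × C := ContinuousLinearEquiv.equivOfInverse L L'
    (fun z => by
      obtain ⟨c, J⟩ := z
      rw [hLapp]
      simp [L', x₀, κ])
    (fun z => by
      obtain ⟨c, J⟩ := z
      simp only [L', ContinuousLinearMap.prod_apply]
      simp [hLapp, x₀, κ])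
  obtain ⟨e, he, hxe, hsrc, hsymm, hder⟩ :=
    (contDiff_curveMap X hX).contDiffOn.exists_openPartialHomeomorph hU₀ (a := x₀)
      (fun _ => hx) (f' := A) hL
  let ι : ℂ × E →L[ℝ] ℂ × C := (ContinuousLinearMap.fst ℝ ℂ E).prod
    ((ContinuousLinearMap.const ℝ unitInterval).comp (ContinuousLinearMap.snd ℝ ℂ E))
  have hι : ∀ z : ℂ × E, ι z = (z.1, ContinuousMap.const _ z.2) := fun z => rfl
  let one : unitInterval := 1
  let ev : ℂ × C →L[ℝ] E :=
    (ContinuousMap.evalCLM ℝ one).comp (ContinuousLinearMap.snd ℝ ℂ C)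
  have hx₀ : curveMap X x₀ = ι (0, x) := by simp [curveMap, x₀, hι]
  have hpt : ∀ z ∈ ι ⁻¹' e.target, ∃ γ : C, e.symm (ι z) = (z.1, γ) ∧ (∀ t, γ t ∈ B) ∧
      ∀ t, γ t = z.2 + z.1 • unitInterval.primitive E (X.comp γ) t := by
    intro z hz
    have h1 := e.right_inv hz
    have h2 := hsrc (e.map_target hz)
    rw [he, hι] at h1
    rw [hι] at h2
    obtain ⟨hz1, hz2⟩ := Prod.ext_iff.1 h1
    simp only [curveMap] at hz1 hz2
    refine ⟨(e.symm (ι z)).2, Prod.ext hz1 rfl, h2, fun t => ?_⟩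
    have h3 := DFunLike.congr_fun hz2 t
    rw [hz1] at h3
    simp only [ContinuousMap.sub_apply, ContinuousMap.smul_apply, ContinuousMap.const_apply] at h3
    rw [hι]
    exact sub_eq_iff_eq_add.1 h3
  refine ⟨ι ⁻¹' e.target, fun z => ev (e.symm (ι z)), e.open_target.preimage ι.continuous, ?_,
    ev.contDiff.comp_contDiffOn (hsymm.comp ι.contDiff.contDiffOn fun _ h => h), fun z hz => ?_⟩
  · rw [Set.mem_preimage, ← hx₀, ← he]
    exact e.map_source hxe
  obtain ⟨γ, hγe, hγB, hγ⟩ := hpt z hz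
  have hev : ev (e.symm (ι z)) = γ 1 := by rw [hγe]; rfl
  refine ⟨(congrArg (· ∈ B) hev).mpr (hγB 1), fun h0 => ?_, fun c => ?_⟩
  · simp only [hev]
    rw [hγ, h0]
    simp
  obtain ⟨T, hT, hTs⟩ := hder _ (e.map_target hz)
  rw [show curveMap X (e.symm (ι z)) = ι z from he ▸ e.right_inv hz] at hTs
  obtain ⟨M, hM, hMapp⟩ := hasFDerivAt_curveMap X hX (e.symm (ι z))
  let J : C := ⟨fun t => ((t : ℝ) * c : ℂ) • X (γ t), by fun_prop⟩
  have hTJ : T (c, J) = (c, 0) := by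
    rw [← ContinuousLinearEquiv.coe_coe, hT.unique hM, hMapp, hγe]
    simp only
    rw [primitive_variation X hX z.1 c z.2 γ hγ (fun t => hlin _ (hγB t)) J fun t => rfl, sub_self]
  have hΓ := (ev.hasFDerivAt.comp _ (hTs.comp z ι.hasFDerivAt)).fderiv
  have : fderiv ℝ (fun z => ev (e.symm (ι z))) z (c, 0) = ev (T.symm (ι (c, 0))) :=
    congrArg (fun L : ℂ × E →L[ℝ] E => L (c, 0)) hΓ
  rw [this, show ι (c, 0) = T (c, J) from hTJ ▸ rfl, T.symm_apply_apply]
  simp only [hev]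
  change ((((1 : unitInterval) : ℝ) : ℂ) * c) • X (γ 1) = _
  simp
end

theorem exists_normalized_field {E : Type} [NormedAddCommGroup E] [NormedSpace ℂ E]
    [NormedSpace ℝ E] [IsScalarTower ℝ ℂ E] [FiniteDimensional ℝ E]
    {x : E} {N : Set E} (hN : IsOpen N) (hxN : x ∈ N) {V : E → E} (hV : ContDiffOn ℝ ∞ V N)
    (hVx : V x ≠ 0)
    (hinv : ∀ p ∈ N, ∃ c : ℂ, fderiv ℝ (fun q => Complex.I • V q) p (V p)
        - fderiv ℝ V p (Complex.I • V p) = c • V p) {m : ℕ}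
    (hhom : ∀ p ∈ N, ∀ t : ℝ, t • p ∈ N → V (t • p) = (t ^ m : ℝ) • V p) :
    ∃ (X : E → E) (φ : E → ℂ) (r : ℝ), ContDiff ℝ ∞ X ∧ 0 < r ∧ Metric.ball x r ⊆ N ∧
      (∀ p ∈ Metric.ball x r, φ p ≠ 0 ∧ X p = φ p • V p) ∧
      (∀ p ∈ Metric.ball x r, ∀ t : ℝ, t ≠ 0 → t • p ∈ Metric.ball x r → X (t • p) = X p) ∧
      ∀ p ∈ Metric.ball x r, ∀ c : ℂ, fderiv ℝ X p (c • X p) = c • fderiv ℝ X p (X p) := by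
  have hcoe (t : ℝ) (v : E) : (t : ℂ) • v = t • v := algebraMap_smul ℂ t v
  obtain ⟨l, hl⟩ := SeparatingDual.exists_ne_zero (R := ℂ) hVx
  have hlV : ContDiffOn ℝ ∞ (fun p => l (V p)) N :=
    (l.restrictScalars ℝ).contDiff.comp_contDiffOn hV
  set O : Set E := N ∩ (fun p => l (V p)) ⁻¹' {0}ᶜ
  have hO : IsOpen O := hlV.continuousOn.isOpen_inter_preimage hN isOpen_compl_singleton
  set φ : E → ℂ := fun p => (l (V p))⁻¹ with hφ_def
  have hφ : ContDiffOn ℝ ∞ φ O :=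
    (hlV.mono Set.inter_subset_left).inv fun p hp => hp.2
  have hX₀ : ContDiffOn ℝ ∞ (fun p => φ p • V p) O := hφ.smul (hV.mono Set.inter_subset_left)
  obtain ⟨ε, hε, hεO⟩ := Metric.nhds_basis_closedBall.mem_iff.1
    (hO.mem_nhds (show x ∈ O from ⟨hxN, hl⟩))
  let f : ContDiffBump x := ⟨ε / 2, ε, half_pos hε, half_lt_self hε⟩
  let X : E → E := fun p => f p • (φ p • V p)
  have hXeq : ∀ p ∈ Metric.ball x (ε / 2), X p = φ p • V p := fun p hp => by
    simp [X, f.one_of_mem_closedBall (Metric.ball_subset_closedBall hp)]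
  have hballO : Metric.ball x (ε / 2) ⊆ O := fun p hp =>
    hεO (Metric.ball_subset_closedBall (Metric.ball_subset_ball (half_lt_self hε).le hp))
  refine ⟨X, φ, ε / 2, ?_, half_pos hε, hballO.trans Set.inter_subset_left,
    fun p hp => ⟨inv_ne_zero (hballO hp).2, hXeq p hp⟩, ?_, ?_⟩
  · refine contDiff_iff_contDiffAt.2 fun p => ?_
    by_cases hp : p ∈ O
    · exact f.contDiff.contDiffAt.smul (hX₀.contDiffAt (hO.mem_nhds hp))
    · have hp' : p ∈ (tsupport f)ᶜ := by
        rw [f.tsupport_eq]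
        exact fun h => hp (hεO h)
      refine (contDiffAt_const (c := (0 : E))).congr_of_eventuallyEq ?_
      filter_upwards [(isClosed_tsupport f).isOpen_compl.mem_nhds hp'] with q hq
      simp [X, image_eq_zero_of_notMem_tsupport hq]
  · intro p hp t ht htp
    have htm : ((t : ℂ) ^ m) ≠ 0 := pow_ne_zero _ (Complex.ofReal_ne_zero.2 ht)
    have h1 : V (t • p) = ((t : ℂ) ^ m) • V p := by
      rw [hhom p (hballO hp).1 t (hballO htp).1, ← Complex.ofReal_pow, hcoe]
    rw [hXeq _ hp, hXeq _ htp]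
    simp only [hφ_def, h1, map_smul, smul_eq_mul, smul_smul]
    congr 1
    have := (hballO hp).2
    simp only [Set.mem_preimage, Set.mem_compl_iff, Set.mem_singleton_iff] at this
    field_simp
  · intro p hp
    have hpO := hballO hp
    have hVd : DifferentiableAt ℝ V p :=
      (hV.contDiffAt (hN.mem_nhds hpO.1)).differentiableAt (by simp)
    have hφd : DifferentiableAt ℝ φ p :=
      (hφ.contDiffAt (hO.mem_nhds hpO)).differentiableAt (by simp)
    have hev : X =ᶠ[nhds p] fun q => φ q • V q :=
      Filter.eventually_of_mem (Metric.isOpen_ball.mem_nhds hp) hXeq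
    have hXd := (hφd.hasFDerivAt.smul hVd.hasFDerivAt).congr_of_eventuallyEq hev
    have hl0 : ∀ v, l (fderiv ℝ X p v) = 0 := by
      have h1 : HasFDerivAt (fun q => l (X q)) ((l.restrictScalars ℝ).comp (fderiv ℝ X p)) p :=
        (l.restrictScalars ℝ).hasFDerivAt.comp p hXd.differentiableAt.hasFDerivAt
      have h2 : (fun q => l (X q)) =ᶠ[nhds p] fun _ => (1 : ℂ) := by
        filter_upwards [Metric.isOpen_ball.mem_nhds hp] with q hq
        rw [hXeq q hq, map_smul, smul_eq_mul]
        exact inv_mul_cancel₀ (hballO hq).2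
      intro v
      exact DFunLike.congr_fun
        (h1.unique ((hasFDerivAt_const (1 : ℂ) p).congr_of_eventuallyEq h2)) v
    have hXapp : ∀ v, fderiv ℝ X p v = φ p • fderiv ℝ V p v + fderiv ℝ φ p v • V p := fun v => by
      rw [hXd.fderiv]; rfl
    obtain ⟨c, hc⟩ := hinv p hpO.1
    rw [fderiv_fun_const_smul hVd] at hc
    have hIV : fderiv ℝ V p (Complex.I • V p) = Complex.I • fderiv ℝ V p (V p) - c • V p := by
      rw [← hc]; simp
    have hsplit : ∀ (L : E →L[ℝ] E) (a : ℂ) (v : E),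
        L (a • v) = (a.re : ℂ) • L v + (a.im : ℂ) • L (Complex.I • v) := by
      intro L a v
      conv_lhs => rw [← Complex.re_add_im a, add_smul, mul_smul, hcoe, hcoe]
      rw [map_add, map_smul, map_smul, hcoe, hcoe]
    have hI : fderiv ℝ X p (Complex.I • X p) = Complex.I • fderiv ℝ X p (X p) := by
      obtain ⟨d, hd⟩ : ∃ d : ℂ, Complex.I • fderiv ℝ X p (X p)
          - fderiv ℝ X p (Complex.I • X p) = d • V p := by
        have hre := Complex.re_add_im (φ p)
        have e1 : fderiv ℝ V p (X p) = φ p • fderiv ℝ V p (V p) - ((φ p).im * c) • V p := by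
          rw [hXeq p hp, hsplit, hIV]
          match_scalars
          · linear_combination hre
          · ring
        have e2 : fderiv ℝ V p (Complex.I • X p)
            = (Complex.I * φ p) • fderiv ℝ V p (V p) - ((φ p).re * c) • V p := by
          rw [hXeq p hp, smul_smul, hsplit, hIV]
          simp only [Complex.I_mul_re, Complex.I_mul_im, Complex.ofReal_neg]
          match_scalars
          · linear_combination Complex.I * hre - (φ p).im * Complex.I_sq
          · ring
        refine ⟨Complex.I * (fderiv ℝ φ p (X p) - φ p * ((φ p).im * c))
          - (fderiv ℝ φ p (Complex.I • X p) - φ p * ((φ p).re * c)), ?_⟩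
        rw [hXapp, hXapp, e1, e2]
        module
      have h3 := congrArg l hd
      rw [map_sub, map_smul, hl0, hl0, map_smul, smul_zero, sub_zero, smul_eq_mul] at h3
      have hd0 : d = 0 := (mul_eq_zero.1 h3.symm).resolve_right hpO.2
      rw [hd0, zero_smul] at hd
      exact (sub_eq_zero.1 hd).symm
    intro a
    rw [hsplit, hI]
    conv_rhs => rw [← Complex.re_add_im a]
    module

theorem apply_smul_of_fderiv_apply_self {E : Type*} [NormedAddCommGroup E] [NormedSpace ℝ E]
    {W : Set E} (hWo : IsOpen W) (hWc : Convex ℝ W) (hW0 : (0 : E) ∉ W) {g : E → ℝ}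
    (hg : DifferentiableOn ℝ g W) {n : ℕ} (hE : ∀ p ∈ W, fderiv ℝ g p p = n * g p)
    {p : E} (hp : p ∈ W) {t : ℝ} (ht : t • p ∈ W) : g (t • p) = t ^ n * g p := by
  let T : Set ℝ := (fun s : ℝ => s • p) ⁻¹' W
  have hTo : IsOpen T := hWo.preimage (by fun_prop)
  have hTc : Convex ℝ T := hWc.linear_preimage (LinearMap.toSpanSingleton ℝ E p)
  have h1T : (1 : ℝ) ∈ T := by simpa [T] using hp
  have hne : ∀ s ∈ T, s ≠ 0 := by
    rintro s hs rfl
    exact hW0 (by simpa [T] using hs)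
  have hder : ∀ s ∈ T, HasDerivAt (fun s : ℝ => g (s • p) / s ^ n) 0 s := by
    intro s hs
    have hs0 := hne s hs
    have h1 : HasDerivAt (fun s : ℝ => s • p) p s := by
      simpa using (hasDerivAt_id s).smul_const p
    have h2 := ((hg.differentiableAt (hWo.mem_nhds hs)).hasFDerivAt.comp_hasDerivAt s h1).div
      (hasDerivAt_pow n s) (pow_ne_zero n hs0)
    refine h2.congr_deriv ?_
    have h3 := hE _ hs
    rw [map_smul, smul_eq_mul] at h3
    have h4 : fderiv ℝ g (s • p) p = n * g (s • p) / s := by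
      rw [← h3]; field_simp
    simp only [Function.comp_apply, h4]
    rcases n with _ | n
    · simp
    · rw [Nat.add_sub_cancel]
      field_simp
      ring
  have hconst := hTo.is_const_of_deriv_eq_zero hTc.isPreconnected
    (fun s hs => (hder s hs).differentiableAt.differentiableWithinAt)
    (fun s hs => (hder s hs).deriv) (show t ∈ T from ht) h1T
  have htn : t ^ n ≠ 0 := pow_ne_zero n (hne t ht)
  simp only [one_smul, one_pow, div_one] at hconst
  rw [← hconst]
  field_simp

section
variable {E : Type} [NormedAddCommGroup E] [NormedSpace ℂ E] [NormedSpace ℝ E]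

/-- The scaled flow: leaf through the point `x + (im w) • i x` at complex time `ζ`, dilated by
the factor `exp (re w)`. -/
noncomputable def scaledFlow (x : E) (Γ : ℂ × E → E) (z : ℂ × ℂ) : E :=
  Real.exp z.1.re • Γ (z.2, x + z.1.im • Complex.I • x)

theorem hasFDerivAt_scaledFlow {x : E} {Γ : ℂ × E → E} {z : ℂ × ℂ}
    (hΓ : DifferentiableAt ℝ Γ (z.2, x + z.1.im • Complex.I • x)) :
    ∃ L : ℂ × ℂ →L[ℝ] E, HasFDerivAt (scaledFlow x Γ) L z ∧
      ∀ a c, L (a, c) = Real.exp z.1.re • fderiv ℝ Γ (z.2, x + z.1.im • Complex.I • x)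
          (c, a.im • Complex.I • x)
        + (Real.exp z.1.re * a.re) • Γ (z.2, x + z.1.im • Complex.I • x) := by
  let K : ℂ × ℂ →L[ℝ] ℂ × E := (ContinuousLinearMap.snd ℝ ℂ ℂ).prod
    ((Complex.imCLM.comp (ContinuousLinearMap.fst ℝ ℂ ℂ)).smulRight (Complex.I • x))
  have hK : HasFDerivAt (fun z : ℂ × ℂ => (z.2, x + z.1.im • Complex.I • x)) K z :=
    hasFDerivAt_snd.prodMk
      (((Complex.imCLM.comp (ContinuousLinearMap.fst ℝ ℂ ℂ)).smulRight
        (Complex.I • x)).hasFDerivAt.const_add x)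
  have hexp := (Complex.reCLM.comp (ContinuousLinearMap.fst ℝ ℂ ℂ)).hasFDerivAt (x := z) |>.exp
  exact ⟨_, hexp.smul (hΓ.hasFDerivAt.comp z hK), fun a c => rfl⟩

theorem exists_foliated_scaling_chart [IsScalarTower ℝ ℂ E] [FiniteDimensional ℝ E]
    (hdim : Module.finrank ℝ E = 4)
    {X : E → E} (hX : ContDiff ℝ ∞ X) {B : Set E} (hB : IsOpen B) {x : E} (hx : x ∈ B)
    (hhom : ∀ p ∈ B, ∀ t : ℝ, t ≠ 0 → t • p ∈ B → X (t • p) = X p)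
    (hlin : ∀ p ∈ B, ∀ c : ℂ, fderiv ℝ X p (c • X p) = c • fderiv ℝ X p (X p))
    (hind : LinearIndependent ℂ ![x, X x]) :
    ∃ (W : Set E) (h : E → ℝ), IsOpen W ∧ x ∈ W ∧ ContDiffOn ℝ ∞ h W ∧
      ∀ p ∈ W, fderiv ℝ h p p = 1 ∧ ∀ c : ℂ, fderiv ℝ h p (c • X p) = 0 := by
  have hcoe (t : ℝ) (v : E) : (t : ℂ) • v = t • v := algebraMap_smul ℂ t v
  have : CompleteSpace E := FiniteDimensional.complete ℝ E
  obtain ⟨U, Γ, hU, hxU, hΓ, hΓU⟩ :=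
    exists_smooth_complex_flow ⟨X, hX.continuous⟩ hX hB hx hlin
  simp only [ContinuousMap.coe_mk] at hΓU
  let κ : ℂ × ℂ → ℂ × E := fun z => (z.2, x + z.1.im • Complex.I • x)
  have hκ : ContDiff ℝ ∞ κ := contDiff_snd.prodMk
    (contDiff_const.add ((Complex.imCLM.contDiff.comp contDiff_fst).smul contDiff_const))
  have hΨ : ContDiffOn ℝ ∞ (scaledFlow x Γ) (κ ⁻¹' U) :=
    (Real.contDiff_exp.comp (Complex.reCLM.contDiff.comp contDiff_fst)).contDiffOn.smul
      (hΓ.comp hκ.contDiffOn fun _ h => h)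
  have hO : IsOpen (κ ⁻¹' U ∩ scaledFlow x Γ ⁻¹' B) :=
    hΨ.continuousOn.isOpen_inter_preimage (hU.preimage hκ.continuous) hB
  have hΓd : ∀ z ∈ U, DifferentiableAt ℝ Γ z := fun z hz =>
    (hΓ.contDiffAt (hU.mem_nhds hz)).differentiableAt (by simp)
  have hκ0 : κ 0 = (0, x) := by simp [κ]
  have hΓ0 : Γ (0, x) = x := (hΓU _ hxU).2.1 rfl
  have hΨ0 : scaledFlow x Γ 0 = x := by
    change Real.exp (0 : ℂ).re • Γ (κ 0) = x
    rw [hκ0, hΓ0]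
    simp
  have h0 : (0 : ℂ × ℂ) ∈ κ ⁻¹' U ∩ scaledFlow x Γ ⁻¹' B :=
    ⟨by rwa [Set.mem_preimage, hκ0], by rwa [Set.mem_preimage, hΨ0]⟩
  obtain ⟨L, hL, hLapp⟩ := hasFDerivAt_scaledFlow (x := x) (hΓd _ h0.1)
  have hL' : ∀ a c, L (a, c) = a • x + c • X x := by
    intro a c
    have h1 : ∀ v, fderiv ℝ Γ (0, x) (0, v) = v := by
      intro v
      have h2 := (hΓd _ hxU).hasFDerivAt.comp x
        (hasFDerivAt_prodMk_right (𝕜 := ℝ) (0 : ℂ) x)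
      have h3 : (Γ ∘ fun q => ((0 : ℂ), q)) =ᶠ[nhds x] id := by
        filter_upwards [(hU.preimage (continuous_const.prodMk continuous_id)).mem_nhds hxU]
          with q hq using (hΓU _ hq).2.1 rfl
      exact DFunLike.congr_fun (h2.unique ((hasFDerivAt_id x).congr_of_eventuallyEq h3)) v
    rw [hLapp]
    change Real.exp (0 : ℂ).re • fderiv ℝ Γ (κ 0) _ + (Real.exp (0 : ℂ).re * a.re) • Γ (κ 0) = _
    rw [hκ0, hΓ0, Complex.zero_re, Real.exp_zero, one_smul, one_mul,
      show (c, a.im • Complex.I • x) = (c, (0 : E)) + (0, a.im • Complex.I • x) by simp,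
      map_add, h1, (hΓU _ hxU).2.2, hΓ0]
    conv_rhs => rw [← Complex.re_add_im a, add_smul, mul_smul, hcoe, hcoe]
    abel
  have hinj : Function.Injective (L : ℂ × ℂ →ₗ[ℝ] E) := by
    rw [← LinearMap.ker_eq_bot, LinearMap.ker_eq_bot']
    rintro ⟨a, c⟩ h
    have h' : a • x + c • X x = 0 := (hL' a c).symm.trans h
    obtain ⟨rfl, rfl⟩ := LinearIndependent.pair_iff.1 hind a c h'
    rfl
  let A : (ℂ × ℂ) ≃L[ℝ] E := (LinearEquiv.ofInjectiveOfFinrankEq (L : ℂ × ℂ →ₗ[ℝ] E) hinj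
    (by rw [hdim]; simp [Complex.finrank_real_complex])).toContinuousLinearEquiv
  have hA : (A : ℂ × ℂ →L[ℝ] E) = L := by ext z <;> rfl
  obtain ⟨e, he, h0e, hsrc, hsymm, hder⟩ :=
    (hΨ.mono Set.inter_subset_left).exists_openPartialHomeomorph hO h0 (f' := A) (hA ▸ hL)
  refine ⟨e.target, fun p => (e.symm p).1.re, e.open_target, ?_,
    (Complex.reCLM.comp (ContinuousLinearMap.fst ℝ ℂ ℂ)).contDiff.comp_contDiffOn hsymm,
    fun p hp => ?_⟩
  · rw [← hΨ0, ← he]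
    exact e.map_source h0e
  obtain ⟨T, hT, hTs⟩ := hder _ (e.map_target hp)
  have hzO := hsrc (e.map_target hp)
  have hzp : scaledFlow x Γ (e.symm p) = p := he ▸ e.right_inv hp
  rw [hzp] at hTs
  have hh : HasFDerivAt (fun p => (e.symm p).1.re)
      ((Complex.reCLM.comp (ContinuousLinearMap.fst ℝ ℂ ℂ)).comp (T.symm : E →L[ℝ] ℂ × ℂ)) p :=
    (Complex.reCLM.comp (ContinuousLinearMap.fst ℝ ℂ ℂ)).hasFDerivAt.comp p hTs
  have hhapp : ∀ v, fderiv ℝ (fun p => (e.symm p).1.re) p v = (T.symm v).1.re := fun v => by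
    rw [hh.fderiv]; rfl
  generalize e.symm p = z at hT hzO hzp
  obtain ⟨M, hM, hMapp⟩ := hasFDerivAt_scaledFlow (x := x) (hΓd _ hzO.1)
  have hTM : ∀ v, T v = M v := fun v => DFunLike.congr_fun (hT.unique hM) v
  obtain ⟨hΓB, -, hΓc⟩ := hΓU _ hzO.1
  have hexp : Real.exp z.1.re ≠ 0 := (Real.exp_pos _).ne'
  have hzp' : Real.exp z.1.re • Γ (κ z) = p := hzp
  have hXp : X p = X (Γ (κ z)) := by
    rw [← hzp']
    exact hhom _ hΓB _ hexp (hzp' ▸ hzp ▸ hzO.2)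
  refine ⟨?_, fun c => ?_⟩
  · have hT1 : T (1, 0) = p := by
      rw [hTM, hMapp, Complex.one_im, zero_smul, Complex.one_re, mul_one]
      erw [map_zero]
      rw [smul_zero, zero_add]
      exact hzp'
    have h1 : T.symm p = (1, 0) := by rw [← hT1, T.symm_apply_apply]
    rw [hhapp, h1, Complex.one_re]
  · have hT2 : T (0, ((Real.exp z.1.re)⁻¹ : ℝ) * c) = c • X p := by
      rw [hTM, hMapp, Complex.zero_im, zero_smul, Complex.zero_re, mul_zero, zero_smul, add_zero]
      erw [hΓc]
      rw [mul_smul, hcoe, smul_inv_smul₀ hexp, hXp]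
    rw [hhapp, ← hT2, T.symm_apply_apply, Complex.zero_re]

end


/-!
STATEMENT 0: Under the Setup (x ∈ ℂ²∖{0}, N ⊆ ℂ²∖{0} an open neighborhood of x,
𝒱 : N → ℂ² a smooth nowhere-vanishing vector field which is involutive
([𝒱, i𝒱](p) ∈ span_ℂ{𝒱(p)}), ℝ-homogeneous of degree m, and transversal
(p ∉ span_ℂ{𝒱(p)})), for every positive integer n there is an open neighborhood
W ⊆ N of x with W ∩ (−W) = ∅ and a C^∞ function g : W → ℝ which is positive,
ℝ-homogeneous of degree n, and whose real Fréchet derivative annihilates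
c·𝒱(p) for every p ∈ W, c ∈ ℂ.
-/

theorem statement0
    (x : ℂ × ℂ) (hx : x ≠ 0)
    (N : Set (ℂ × ℂ)) (hNopen : IsOpen N) (hxN : x ∈ N)
    (hNne0 : ∀ p ∈ N, p ≠ (0 : ℂ × ℂ))
    (V : ℂ × ℂ → ℂ × ℂ)
    (hVsmooth : ContDiffOn ℝ (⊤ : ℕ∞) V N)
    (hVne : ∀ p ∈ N, V p ≠ 0)
    (m : ℕ) (hm : 0 < m)
    (hinv : ∀ p ∈ N, ∃ c : ℂ,
      fderiv ℝ (fun q => Complex.I • V q) p (V p)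
        - fderiv ℝ V p (Complex.I • V p) = c • V p)
    (hhom : ∀ p ∈ N, ∀ t : ℝ, t • p ∈ N → V (t • p) = (t ^ m : ℝ) • V p)
    (htrans : ∀ p ∈ N, ∀ c : ℂ, p ≠ c • V p)
    (n : ℕ) (hn : 0 < n) :
    ∃ W : Set (ℂ × ℂ), IsOpen W ∧ x ∈ W ∧ W ⊆ N ∧ (∀ p ∈ W, -p ∉ W) ∧
      ∃ g : ℂ × ℂ → ℝ,
        ContDiffOn ℝ (⊤ : ℕ∞) g W ∧
        (∀ p ∈ W, 0 < g p) ∧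
        (∀ p ∈ W, ∀ t : ℝ, t • p ∈ W → g (t • p) = t ^ n * g p) ∧
        (∀ p ∈ W, ∀ c : ℂ, fderiv ℝ g p (c • V p) = 0) := by
  have hfin : Module.finrank ℝ (ℂ × ℂ) = 4 := by simp [Complex.finrank_real_complex]
  obtain ⟨X, φ, r, hX, hr, hrN, hφ, hXhom, hXlin⟩ :=
    exists_normalized_field hNopen hxN hVsmooth (hVne x hxN) hinv hhom
  have hxr : x ∈ Metric.ball x r := Metric.mem_ball_self hr
  have hind : LinearIndependent ℂ ![x, X x] := by
    refine (LinearIndependent.pair_symm_iff).1 ?_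
    have hXx : X x ≠ 0 := by
      rw [(hφ x hxr).2]
      exact smul_ne_zero (hφ x hxr).1 (hVne x hxN)
    refine (LinearIndependent.pair_iff' hXx).2 fun a ha => htrans x hxN (a * φ x) ?_
    rw [mul_smul, ← (hφ x hxr).2, ha]
  obtain ⟨W₀, h, hW₀, hxW₀, hh, hder⟩ :=
    exists_foliated_scaling_chart hfin hX Metric.isOpen_ball hxr hXhom hXlin hind
  obtain ⟨ρ, hρ, hρsub⟩ := Metric.isOpen_iff.1 (hW₀.inter Metric.isOpen_ball) x ⟨hxW₀, hxr⟩
  have hWN : Metric.ball x ρ ⊆ N := fun p hp => hrN (hρsub hp).2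
  have hW0 : (0 : ℂ × ℂ) ∉ Metric.ball x ρ := fun h0 => hNne0 0 (hWN h0) rfl
  have hgs : ContDiffOn ℝ (⊤ : ℕ∞) (fun p => Real.exp (n * h p)) (Metric.ball x ρ) :=
    Real.contDiff_exp.comp_contDiffOn
      (contDiffOn_const.mul (hh.mono fun p hp => (hρsub hp).1))
  have hgd : ∀ p ∈ Metric.ball x ρ, ∀ v, fderiv ℝ (fun p => Real.exp (n * h p)) p v
      = Real.exp (n * h p) * (n * fderiv ℝ h p v) := by
    intro p hp v
    have hd := (hh.contDiffAt (hW₀.mem_nhds (hρsub hp).1)).differentiableAt (by simp)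
    rw [((hd.hasFDerivAt.const_mul (n : ℝ)).exp).fderiv]
    rfl
  refine ⟨Metric.ball x ρ, Metric.isOpen_ball, Metric.mem_ball_self hρ, hWN, fun p hp hnp => ?_,
    fun p => Real.exp (n * h p), hgs, fun p _ => Real.exp_pos _, fun p hp t htp => ?_,
    fun p hp c => ?_⟩
  · have := (convex_ball x ρ).midpoint_mem hp hnp
    rw [midpoint_self_neg] at this
    exact hW0 this
  · refine apply_smul_of_fderiv_apply_self Metric.isOpen_ball (convex_ball x ρ) hW0
      (hgs.differentiableOn (by simp)) (fun q hq => ?_) hp htp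
    rw [hgd q hq, (hder q (hρsub hq).1).1]
    ring
  · obtain ⟨hφp, hXp⟩ := hφ p (hρsub hp).2
    have hcV : c • V p = (c * (φ p)⁻¹) • X p := by
      rw [hXp, smul_smul, inv_mul_cancel_right₀ hφp]
    rw [hgd p hp, hcV, (hder p (hρsub hp).1).2, mul_zero, mul_zero]
end

section
/- Under the Setup, suppose φ, u : N → ℂ are smooth maps such that Φ := (φ, u) : N → 𝔻 × 𝔻 is a C^∞ diffeomorphism and, for every p ∈ N, the kernel of the real Fréchet derivative of u at p equals span_ℂ{𝒱(p)}. Let 𝔻_{1/2} denote the open disc of radius 1/2 centered at 0 in ℂ. Then there exists δ ∈ (0,1) such that for all t ∈ (1−δ, 1+δ) and all a, b ∈ Φ^{−1}(𝔻_{1/2} × 𝔻_{1/2}): t·a ∈ N and t·b ∈ N, and moreover if u(a) = u(b) then u(t·a) = u(t·b). -/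
/-!
STATEMENT 3: Under the Setup, given smooth φ, u : N → ℂ such that Φ = (φ,u) is
a C^∞ diffeomorphism of N onto 𝔻 × 𝔻 and ker(Du(p)) = span_ℂ{𝒱(p)} for every
p ∈ N, there exists δ ∈ (0,1) such that for all t ∈ (1−δ,1+δ) and all
a, b ∈ Φ⁻¹(𝔻_{1/2} × 𝔻_{1/2}): t·a, t·b ∈ N, and u(a) = u(b) implies
u(t·a) = u(t·b).
-/

theorem statement3
    (x : ℂ × ℂ) (hx : x ≠ 0)
    (N : Set (ℂ × ℂ)) (hNopen : IsOpen N) (hxN : x ∈ N)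
    (hNne0 : ∀ p ∈ N, p ≠ (0 : ℂ × ℂ))
    (V : ℂ × ℂ → ℂ × ℂ)
    (hVsmooth : ContDiffOn ℝ (⊤ : ℕ∞) V N)
    (hVne : ∀ p ∈ N, V p ≠ 0)
    (m : ℕ) (hm : 0 < m)
    (hinv : ∀ p ∈ N, ∃ c : ℂ,
      fderiv ℝ (fun q => Complex.I • V q) p (V p)
        - fderiv ℝ V p (Complex.I • V p) = c • V p)
    (hhom : ∀ p ∈ N, ∀ t : ℝ, t • p ∈ N → V (t • p) = (t ^ m : ℝ) • V p)
    (htrans : ∀ p ∈ N, ∀ c : ℂ, p ≠ c • V p)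
    (φ u : ℂ × ℂ → ℂ)
    (hφ : ContDiffOn ℝ (⊤ : ℕ∞) φ N) (hu : ContDiffOn ℝ (⊤ : ℕ∞) u N)
    (hΦmaps : Set.MapsTo (fun p => (φ p, u p)) N
      (Metric.ball (0 : ℂ) 1 ×ˢ Metric.ball (0 : ℂ) 1))
    (Ψ : ℂ × ℂ → ℂ × ℂ)
    (hΨ : ContDiffOn ℝ (⊤ : ℕ∞) Ψ (Metric.ball (0 : ℂ) 1 ×ˢ Metric.ball (0 : ℂ) 1))
    (hΨmaps : Set.MapsTo Ψ (Metric.ball (0 : ℂ) 1 ×ˢ Metric.ball (0 : ℂ) 1) N)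
    (hleft : ∀ p ∈ N, Ψ (φ p, u p) = p)
    (hright : ∀ q ∈ Metric.ball (0 : ℂ) 1 ×ˢ Metric.ball (0 : ℂ) 1,
      (φ (Ψ q), u (Ψ q)) = q)
    (hker : ∀ p ∈ N, ∀ v : ℂ × ℂ, fderiv ℝ u p v = 0 ↔ ∃ c : ℂ, v = c • V p) :
    ∃ δ ∈ Set.Ioo (0 : ℝ) 1, ∀ t ∈ Set.Ioo (1 - δ) (1 + δ),
      ∀ a ∈ N, ∀ b ∈ N,
        φ a ∈ Metric.ball (0 : ℂ) (1 / 2) → u a ∈ Metric.ball (0 : ℂ) (1 / 2) →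
        φ b ∈ Metric.ball (0 : ℂ) (1 / 2) → u b ∈ Metric.ball (0 : ℂ) (1 / 2) →
        t • a ∈ N ∧ t • b ∈ N ∧ (u a = u b → u (t • a) = u (t • b)) := by
  have hK : IsCompact
      (Ψ '' (Metric.closedBall (0 : ℂ) (1 / 2) ×ˢ Metric.closedBall (0 : ℂ) (1 / 2))) := by
    refine ((isCompact_closedBall _ _).prod (isCompact_closedBall _ _)).image_of_continuousOn
      (hΨ.continuousOn.mono ?_)
    exact Set.prod_mono (Metric.closedBall_subset_ball (by norm_num))
      (Metric.closedBall_subset_ball (by norm_num))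
  have hev : ∀ᶠ t : ℝ in nhds 1, ∀ p ∈
      Ψ '' (Metric.closedBall (0 : ℂ) (1 / 2) ×ˢ Metric.closedBall (0 : ℂ) (1 / 2)),
      t • p ∈ N := by
    refine hK.eventually_forall_of_forall_eventually ?_
    rintro p ⟨q, hq, rfl⟩
    have hqN : Ψ q ∈ N := hΨmaps
      (Set.prod_mono (Metric.closedBall_subset_ball (by norm_num))
        (Metric.closedBall_subset_ball (by norm_num)) hq)
    have hc : Continuous fun z : ℝ × (ℂ × ℂ) => z.1 • z.2 := continuous_fst.smul continuous_snd
    exact hc.continuousAt.eventually_mem (hNopen.mem_nhds (by simpa using hqN))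
  obtain ⟨ε, hε, hball⟩ := Metric.eventually_nhds_iff.1 hev
  refine ⟨min ε (1 / 2), ⟨by positivity, (min_le_right _ _).trans_lt (by norm_num)⟩, ?_⟩
  intro t ht a ha b hb hφa hua hφb hub
  have h1 := min_le_left ε (1 / 2)
  have h2 := min_le_right ε (1 / 2)
  have ht0 : 0 < t := by linarith [ht.1]
  have htK := hball (y := t) (by
    rw [Real.dist_eq, abs_lt]; constructor <;> linarith [ht.1, ht.2])
  have hmem : ∀ z ∈ Metric.ball (0 : ℂ) (1 / 2), ∀ w ∈ Metric.ball (0 : ℂ) (1 / 2),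
      t • Ψ (z, w) ∈ N := fun z hz w hw =>
    htK _ ⟨(z, w), ⟨Metric.ball_subset_closedBall hz, Metric.ball_subset_closedBall hw⟩, rfl⟩
  have hta : t • a ∈ N := by simpa [hleft a ha] using hmem _ hφa _ hua
  have htb : t • b ∈ N := by simpa [hleft b hb] using hmem _ hφb _ hub
  refine ⟨hta, htb, fun hab => ?_⟩
  have hhalf : Metric.ball (0 : ℂ) (1 / 2) ⊆ Metric.ball 0 1 :=
    Metric.ball_subset_ball (by norm_num)
  have hu' : ∀ p ∈ N, HasFDerivAt u (fderiv ℝ u p) p := fun p hp =>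
    ((hu.contDiffAt (hNopen.mem_nhds hp)).differentiableAt (by simp)).hasFDerivAt
  have hderiv : ∀ z ∈ Metric.ball (0 : ℂ) (1 / 2),
      HasFDerivAt (fun z => u (t • Ψ (z, u a))) (0 : ℂ →L[ℝ] ℂ) z := by
    intro z hz
    have hz1 : (z, u a) ∈ Metric.ball (0 : ℂ) 1 ×ˢ Metric.ball (0 : ℂ) 1 :=
      ⟨hhalf hz, hhalf hua⟩
    have hpN := hΨmaps hz1
    have hΨz : HasFDerivAt Ψ (fderiv ℝ Ψ (z, u a)) (z, u a) :=
      ((hΨ.contDiffAt ((Metric.isOpen_ball.prod Metric.isOpen_ball).mem_nhds hz1)).differentiableAt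
        (by simp)).hasFDerivAt
    have hslice : HasFDerivAt (fun z => Ψ (z, u a))
        ((fderiv ℝ Ψ (z, u a)).comp (ContinuousLinearMap.inl ℝ ℂ ℂ)) z :=
      hΨz.comp z (hasFDerivAt_prodMk_left z (u a))
    have hcomp := (hu' _ hpN).comp z hslice
    have hconst : HasFDerivAt (u ∘ fun z => Ψ (z, u a)) (0 : ℂ →L[ℝ] ℂ) z := by
      refine (hasFDerivAt_const (u a) z).congr_of_eventuallyEq ?_
      filter_upwards [Metric.isOpen_ball.mem_nhds hz] with y hy
      exact congrArg Prod.snd (hright (y, u a) ⟨hhalf hy, hhalf hua⟩)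
    have hzero := hcomp.unique hconst
    have htN := hmem z hz _ hua
    have hscaled := (hu' _ htN).comp z (hslice.const_smul t)
    refine HasFDerivAt.congr_fderiv (f := fun z => u (t • Ψ (z, u a))) hscaled ?_
    ext1 v
    have hv : fderiv ℝ u (Ψ (z, u a)) (fderiv ℝ Ψ (z, u a) (v, 0)) = 0 := by
      simpa using DFunLike.congr_fun hzero v
    obtain ⟨c, hc⟩ := (hker _ hpN _).1 hv
    have hs : fderiv ℝ u (t • Ψ (z, u a)) (fderiv ℝ Ψ (z, u a) (v, 0)) = 0 := by
      refine (hker _ htN _).2 ⟨c * ((t ^ m : ℝ) : ℂ)⁻¹, ?_⟩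
      have htm : ((t ^ m : ℝ) : ℂ) ≠ 0 := by exact_mod_cast (pow_pos ht0 m).ne'
      rw [hhom _ hpN t htN, hc, ← Complex.coe_smul, smul_smul, mul_assoc,
        inv_mul_cancel₀ htm, mul_one]
    simp [hs]
  have key := Metric.isOpen_ball.is_const_of_fderiv_eq_zero (𝕜 := ℝ)
    (convex_ball (0 : ℂ) (1 / 2)).isPreconnected
    (fun z hz => (hderiv z hz).differentiableAt.differentiableWithinAt)
    (fun z hz => (hderiv z hz).fderiv) hφa hφb
  have hb' : Ψ (φ b, u a) = b := by rw [hab, hleft b hb]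
  simpa only [hleft a ha, hb'] using key
end

section
/- Assume the Setup and the Foliation-chart data, and suppose W_x ⊆ N is an open neighborhood of x such that: (1) W_x ⊆ Φ^{−1}(𝔻 × Ω) and W_x ∩ (−W_x) = ∅; (2) the closure of u(W_x) is a compact subset of Ω; (3) there exist an open subset B_x of the sphere {p ∈ ℂ² : ‖p‖ = ‖x‖} and a real number d_x ∈ (0,1) such that x ∈ B_x, W_x = {t·p : 1−d_x < t < 1+d_x, p ∈ B_x}, and for every q ∈ W_x and every t with (1−d_x)/(1+d_x) < t < (1+d_x)/(1−d_x) one has t·q ∈ N and u(t·q) ∈ Ω. Then for any p₁, p₂ ∈ W_x lying on the same ray from the origin (i.e. p₂ = s·p₁ for some s > 0), one has ω₂(u(p₁)) = ω₂(u(p₂)). -/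
/-!
STATEMENT 6: Under the Setup and the Foliation-chart data (δ, φ, u, Φ = (φ,u)
a diffeomorphism N → 𝔻 × 𝔻 with Φ(x) = 0, inverse Ψ, ker(Du(p)) = span_ℂ{𝒱(p)},
homogeneous scaling of the level sets of u; an open Ω ⊆ 𝔻 containing 0 and a
diffeomorphism ω = (ω₁,ω₂) : Ω → (−1,1)² with ∇ω₂ ≠ 0 on Ω and
⟨∇ω₂(τ), S'_τ(1)⟩ = 0 for τ ∈ Ω, where S'_τ(1) = Du(p_τ)(p_τ), p_τ = Ψ(0,τ)),
if W_x ⊆ N is an open neighborhood of x satisfying the shell conditions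
(W_x ⊆ Φ⁻¹(𝔻 × Ω), W_x ∩ (−W_x) = ∅, closure of u(W_x) compact in Ω, and W_x a
radial shell over a relatively open subset B_x of the Euclidean sphere through
x of radial width (1−d_x, 1+d_x), staying in N with u-values in Ω under radial
scaling by factors in ((1−d_x)/(1+d_x), (1+d_x)/(1−d_x))), then ω₂ ∘ u is
constant along rays from the origin in W_x.
-/

/-- If `u` agrees at `t • a` and `t • b` for `t` near `1`, its radial derivatives at `a` and `b`
coincide. -/
theorem fderiv_apply_self_eq_of_eventually_smul
    {E F : Type*} [NormedAddCommGroup E] [NormedSpace ℝ E]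
    [NormedAddCommGroup F] [NormedSpace ℝ F] {u : E → F} {a b : E}
    (ha : DifferentiableAt ℝ u a) (hb : DifferentiableAt ℝ u b)
    (h : ∀ᶠ t : ℝ in nhds 1, u (t • a) = u (t • b)) :
    fderiv ℝ u a a = fderiv ℝ u b b := by
  have key : ∀ c : E, DifferentiableAt ℝ u c →
      HasDerivAt (fun t : ℝ => u (t • c)) (fderiv ℝ u c c) 1 := by
    intro c hc
    have h1 : HasDerivAt (fun t : ℝ => t • c) c 1 := by
      simpa using (hasDerivAt_id (1 : ℝ)).smul_const c
    have h2 : HasFDerivAt u (fderiv ℝ u c) ((1 : ℝ) • c) := by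
      simpa using hc.hasFDerivAt
    exact h2.comp_hasDerivAt 1 h1
  exact ((key a ha).congr_of_eventuallyEq (h.mono fun t ht => ht.symm)).unique (key b hb)

/-- A function whose radial derivative vanishes along a segment of a ray is constant on it. -/
theorem eq_of_fderiv_apply_self_eq_zero
    {E : Type*} [NormedAddCommGroup E] [NormedSpace ℝ E] {g : E → ℝ} {b : E}
    {I : Set ℝ} (hI : IsOpen I) (hIconn : IsPreconnected I) (hIpos : ∀ t ∈ I, 0 < t)
    (hg : ∀ t ∈ I, DifferentiableAt ℝ g (t • b))
    (h0 : ∀ t ∈ I, fderiv ℝ g (t • b) (t • b) = 0)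
    {t₁ t₂ : ℝ} (h₁ : t₁ ∈ I) (h₂ : t₂ ∈ I) : g (t₁ • b) = g (t₂ • b) := by
  have hd : ∀ t ∈ I, HasDerivAt (fun t : ℝ => g (t • b)) 0 t := by
    intro t ht
    have h1 : HasDerivAt (fun t : ℝ => t • b) b t := by
      simpa using (hasDerivAt_id t).smul_const b
    have h2 := (hg t ht).hasFDerivAt.comp_hasDerivAt t h1
    have h3 : fderiv ℝ g (t • b) b = 0 := by
      have h4 := h0 t ht
      rw [map_smul, smul_eq_zero] at h4
      exact h4.resolve_left (hIpos t ht).ne'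
    rwa [h3] at h2
  exact hI.is_const_of_deriv_eq_zero hIconn
    (fun t ht => (hd t ht).differentiableAt.differentiableWithinAt)
    (fun t ht => (hd t ht).deriv) h₁ h₂

/-- Points on a common ray and a common sphere around the origin have matching radial factors. -/
theorem eq_of_smul_eq_smul_of_sphere {a b : ℂ × ℂ} {R r t : ℝ} (hR : R ≠ 0)
    (ha : ‖a.1‖ ^ 2 + ‖a.2‖ ^ 2 = R) (hb : ‖b.1‖ ^ 2 + ‖b.2‖ ^ 2 = R)
    (hr : 0 ≤ r) (ht : 0 ≤ t) (h : r • a = t • b) : r = t := by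
  have scale : ∀ (c : ℂ × ℂ) (k : ℝ),
      ‖(k • c).1‖ ^ 2 + ‖(k • c).2‖ ^ 2 = k ^ 2 * (‖c.1‖ ^ 2 + ‖c.2‖ ^ 2) := by
    intro c k
    simp only [Prod.smul_fst, Prod.smul_snd, norm_smul, mul_pow, Real.norm_eq_abs, sq_abs]
    ring
  have h1 := scale a r
  rw [h, scale b t, ha, hb] at h1
  exact ((pow_left_inj₀ ht hr two_ne_zero).mp (mul_right_cancel₀ hR h1)).symm

theorem statement6
    (x : ℂ × ℂ) (hx : x ≠ 0)
    (N : Set (ℂ × ℂ)) (hNopen : IsOpen N) (hxN : x ∈ N)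
    (hNne0 : ∀ p ∈ N, p ≠ (0 : ℂ × ℂ))
    (V : ℂ × ℂ → ℂ × ℂ)
    (hVsmooth : ContDiffOn ℝ (⊤ : ℕ∞) V N)
    (hVne : ∀ p ∈ N, V p ≠ 0)
    (m : ℕ) (hm : 0 < m)
    (hinv : ∀ p ∈ N, ∃ c : ℂ,
      fderiv ℝ (fun q => Complex.I • V q) p (V p)
        - fderiv ℝ V p (Complex.I • V p) = c • V p)
    (hhom : ∀ p ∈ N, ∀ t : ℝ, t • p ∈ N → V (t • p) = (t ^ m : ℝ) • V p)
    (htrans : ∀ p ∈ N, ∀ c : ℂ, p ≠ c • V p)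
    -- Foliation-chart data
    (δ : ℝ) (hδ : δ ∈ Set.Ioo (0 : ℝ) 1)
    (φ u : ℂ × ℂ → ℂ)
    (hφ : ContDiffOn ℝ (⊤ : ℕ∞) φ N) (hu : ContDiffOn ℝ (⊤ : ℕ∞) u N)
    (hΦmaps : Set.MapsTo (fun p => (φ p, u p)) N
      (Metric.ball (0 : ℂ) 1 ×ˢ Metric.ball (0 : ℂ) 1))
    (hφx : φ x = 0) (hux : u x = 0)
    (Ψ : ℂ × ℂ → ℂ × ℂ)
    (hΨ : ContDiffOn ℝ (⊤ : ℕ∞) Ψ (Metric.ball (0 : ℂ) 1 ×ˢ Metric.ball (0 : ℂ) 1))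
    (hΨmaps : Set.MapsTo Ψ (Metric.ball (0 : ℂ) 1 ×ˢ Metric.ball (0 : ℂ) 1) N)
    (hleft : ∀ p ∈ N, Ψ (φ p, u p) = p)
    (hright : ∀ q ∈ Metric.ball (0 : ℂ) 1 ×ˢ Metric.ball (0 : ℂ) 1,
      (φ (Ψ q), u (Ψ q)) = q)
    (hker : ∀ p ∈ N, ∀ v : ℂ × ℂ, fderiv ℝ u p v = 0 ↔ ∃ c : ℂ, v = c • V p)
    (hscale : ∀ t ∈ Set.Ioo (1 - δ) (1 + δ), ∀ a ∈ N, ∀ b ∈ N,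
      t • a ∈ N → t • b ∈ N → u a = u b → u (t • a) = u (t • b))
    -- Ω and ω = (ω₁, ω₂)
    (Ω : Set ℂ) (hΩopen : IsOpen Ω) (h0Ω : (0 : ℂ) ∈ Ω)
    (hΩsub : Ω ⊆ Metric.ball (0 : ℂ) 1)
    (ω₁ ω₂ : ℂ → ℝ)
    (hω : ContDiffOn ℝ (⊤ : ℕ∞) (fun τ => (ω₁ τ, ω₂ τ)) Ω)
    (hωmaps : Set.MapsTo (fun τ => (ω₁ τ, ω₂ τ)) Ω
      (Set.Ioo (-1 : ℝ) 1 ×ˢ Set.Ioo (-1 : ℝ) 1))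
    (ψ : ℝ × ℝ → ℂ)
    (hψ : ContDiffOn ℝ (⊤ : ℕ∞) ψ (Set.Ioo (-1 : ℝ) 1 ×ˢ Set.Ioo (-1 : ℝ) 1))
    (hψmaps : Set.MapsTo ψ (Set.Ioo (-1 : ℝ) 1 ×ˢ Set.Ioo (-1 : ℝ) 1) Ω)
    (hωleft : ∀ τ ∈ Ω, ψ (ω₁ τ, ω₂ τ) = τ)
    (hωright : ∀ q ∈ Set.Ioo (-1 : ℝ) 1 ×ˢ Set.Ioo (-1 : ℝ) 1,
      (ω₁ (ψ q), ω₂ (ψ q)) = q)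
    (hω₂ne : ∀ τ ∈ Ω, fderiv ℝ ω₂ τ ≠ 0)
    (horth : ∀ τ ∈ Ω, fderiv ℝ ω₂ τ (fderiv ℝ u (Ψ (0, τ)) (Ψ (0, τ))) = 0)
    -- The shell W_x
    (W_x : Set (ℂ × ℂ)) (hWopen : IsOpen W_x) (hxW : x ∈ W_x) (hWN : W_x ⊆ N)
    (hWΩ : ∀ p ∈ W_x, u p ∈ Ω)
    (hWsym : ∀ p ∈ W_x, -p ∉ W_x)
    (hWcpt : IsCompact (closure (u '' W_x)) ∧ closure (u '' W_x) ⊆ Ω)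
    (B_x : Set (ℂ × ℂ))
    (hBsph : B_x ⊆ {p : ℂ × ℂ | ‖p.1‖ ^ 2 + ‖p.2‖ ^ 2 = ‖x.1‖ ^ 2 + ‖x.2‖ ^ 2})
    (hBopen : ∃ U : Set (ℂ × ℂ), IsOpen U ∧
      B_x = U ∩ {p : ℂ × ℂ | ‖p.1‖ ^ 2 + ‖p.2‖ ^ 2 = ‖x.1‖ ^ 2 + ‖x.2‖ ^ 2})
    (hxB : x ∈ B_x)
    (d_x : ℝ) (hd : d_x ∈ Set.Ioo (0 : ℝ) 1)
    (hWeq : W_x = {q : ℂ × ℂ | ∃ t ∈ Set.Ioo (1 - d_x) (1 + d_x), ∃ p ∈ B_x, q = t • p})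
    (hshell : ∀ q ∈ W_x, ∀ t : ℝ,
      (1 - d_x) / (1 + d_x) < t → t < (1 + d_x) / (1 - d_x) →
      t • q ∈ N ∧ u (t • q) ∈ Ω) :
    ∀ p₁ ∈ W_x, ∀ p₂ ∈ W_x, (∃ s : ℝ, 0 < s ∧ p₂ = s • p₁) →
      ω₂ (u p₁) = ω₂ (u p₂) := by
  have hRne : ‖x.1‖ ^ 2 + ‖x.2‖ ^ 2 ≠ 0 := by
    intro h
    have h1 : ‖x.1‖ = 0 := by nlinarith [sq_nonneg ‖x.1‖, sq_nonneg ‖x.2‖]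
    have h2 : ‖x.2‖ = 0 := by nlinarith [sq_nonneg ‖x.1‖, sq_nonneg ‖x.2‖]
    exact hx (Prod.ext (norm_eq_zero.mp h1) (norm_eq_zero.mp h2))
  have hud : ∀ p ∈ N, DifferentiableAt ℝ u p := fun p hp =>
    (hu.contDiffAt (hNopen.mem_nhds hp)).differentiableAt (by simp)
  have hωd : ∀ τ ∈ Ω, DifferentiableAt ℝ ω₂ τ := fun τ hτ =>
    ((hω.contDiffAt (hΩopen.mem_nhds hτ)).differentiableAt (by simp)).snd
  have hmem : ∀ p ∈ N, ∀ᶠ t : ℝ in nhds 1, t • p ∈ N := by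
    intro p hp
    have hc : Continuous fun t : ℝ => t • p := by fun_prop
    exact hc.continuousAt.eventually_mem (hNopen.mem_nhds (by simpa using hp))
  have hradial : ∀ p ∈ N, u p ∈ Ω → fderiv ℝ (fun q => ω₂ (u q)) p p = 0 := by
    intro p hp hpΩ
    have hτ : ((0 : ℂ), u p) ∈ Metric.ball (0 : ℂ) 1 ×ˢ Metric.ball (0 : ℂ) 1 :=
      ⟨by simp, hΩsub hpΩ⟩
    have hqN := hΨmaps hτ
    have huq : u (Ψ (0, u p)) = u p := congrArg Prod.snd (hright _ hτ)
    have hδ1 : Set.Ioo (1 - δ) (1 + δ) ∈ nhds (1 : ℝ) :=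
      Ioo_mem_nhds (by linarith [hδ.1]) (by linarith [hδ.1])
    have heq : fderiv ℝ u p p = fderiv ℝ u (Ψ (0, u p)) (Ψ (0, u p)) := by
      refine fderiv_apply_self_eq_of_eventually_smul (hud p hp) (hud _ hqN) ?_
      filter_upwards [hδ1, hmem p hp, hmem _ hqN] with t ht htp htq
      exact hscale t ht p hp _ hqN htp htq huq.symm
    have hcomp := (hωd _ hpΩ).hasFDerivAt.comp p (hud p hp).hasFDerivAt
    rw [HasFDerivAt.fderiv (f := fun q => ω₂ (u q)) hcomp, ContinuousLinearMap.comp_apply, heq]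
    exact horth _ hpΩ
  rintro p₁ hp₁ p₂ hp₂ ⟨s, hs, rfl⟩
  rw [hWeq] at hp₁ hp₂
  obtain ⟨t₁, ht₁, b₁, hb₁, rfl⟩ := hp₁
  obtain ⟨t₂, ht₂, b₂, hb₂, h₂⟩ := hp₂
  have hpos : ∀ t ∈ Set.Ioo (1 - d_x) (1 + d_x), 0 < t := fun t ht => by
    linarith [ht.1, hd.2]
  rw [smul_smul] at h₂ ⊢
  have hst : s * t₁ = t₂ :=
    eq_of_smul_eq_smul_of_sphere hRne (hBsph hb₁) (hBsph hb₂)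
      (mul_pos hs (hpos _ ht₁)).le (hpos _ ht₂).le h₂
  have hW : ∀ t ∈ Set.Ioo (1 - d_x) (1 + d_x), t • b₁ ∈ W_x := fun t ht => by
    rw [hWeq]
    exact ⟨t, ht, b₁, hb₁, rfl⟩
  exact eq_of_fderiv_apply_self_eq_zero (g := fun q => ω₂ (u q)) isOpen_Ioo isPreconnected_Ioo hpos
    (fun t ht => (hωd _ (hWΩ _ (hW t ht))).comp _ (hud _ (hWN (hW t ht))))
    (fun t ht => hradial _ (hWN (hW t ht)) (hWΩ _ (hW t ht))) ht₁ (hst ▸ ht₂)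
end

section
/- Assume the Setup, the Foliation-chart data, and that W_x satisfies the shell conditions; assume moreover that ω₂ ∘ u is constant along rays in W_x (i.e. ω₂(u(p₁)) = ω₂(u(p₂)) whenever p₁, p₂ ∈ W_x lie on the same ray from the origin). Let W̃_x be open with x ∈ W̃_x, the closure of W̃_x compact and contained in W_x, and let δ̃_x ∈ (0, δ) be such that t·q ∈ W_x whenever q ∈ W̃_x and t ∈ (1−δ̃_x, 1+δ̃_x). Define M : W̃_x × (1−δ̃_x, 1+δ̃_x) → ℝ by M(q,t) := ω₁(u(t·q)) − ω₁(u(x)). Then ∂M/∂t(x,1) ≠ 0, and consequently there exist an open neighborhood V_x ⊆ W̃_x of x, an open neighborhood 𝓘 ⊆ (1−δ̃_x, 1+δ̃_x) of 1, and a smooth map 𝒯 : V_x → 𝓘 with 𝒯(x) = 1 such that for all (q,t) ∈ V_x × 𝓘: M(q,t) = 0 if and only if t = 𝒯(q). -/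
/-!
STATEMENT 7: Assume the Setup, the Foliation-chart data, the Ω/ω data, the
shell conditions on W_x, and that ω₂ ∘ u is constant along rays in W_x. Let
W̃_x ∋ x be open with compact closure contained in W_x and δ̃_x ∈ (0, δ) with
t·q ∈ W_x whenever q ∈ W̃_x, t ∈ (1−δ̃_x, 1+δ̃_x). With
M(q,t) := ω₁(u(t·q)) − ω₁(u(x)), we have ∂M/∂t(x,1) ≠ 0, and there exist an
open neighborhood V_x ⊆ W̃_x of x, an open neighborhood 𝓘 ⊆ (1−δ̃_x, 1+δ̃_x) of
1, and a smooth 𝒯 : V_x → 𝓘 with 𝒯(x) = 1 such that for (q,t) ∈ V_x × 𝓘: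
M(q,t) = 0 ↔ t = 𝒯(q).
-/

open Set Filter Topology in
/-- Smooth implicit function theorem for one scalar equation in one scalar unknown. -/
theorem exists_contDiffOn_implicit_scalar {E : Type*} [NormedAddCommGroup E] [NormedSpace ℝ E]
    [FiniteDimensional ℝ E] {M : E × ℝ → ℝ} {O : Set (E × ℝ)} (hO : IsOpen O)
    (hM : ContDiffOn ℝ (⊤ : ℕ∞) M O) {x : E} {t₀ : ℝ} (hxO : (x, t₀) ∈ O)
    (h0 : M (x, t₀) = 0) (hd : fderiv ℝ M (x, t₀) (0, 1) ≠ 0)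
    {W : Set E} (hW : W ∈ 𝓝 x) {J : Set ℝ} (hJ : J ∈ 𝓝 t₀) :
    ∃ U : Set E, IsOpen U ∧ x ∈ U ∧ U ⊆ W ∧ ∃ I : Set ℝ, IsOpen I ∧ t₀ ∈ I ∧ I ⊆ J ∧
      ∃ T : E → ℝ, ContDiffOn ℝ (⊤ : ℕ∞) T U ∧ T x = t₀ ∧ MapsTo T U I ∧
        ∀ q ∈ U, ∀ t ∈ I, (M (q, t) = 0 ↔ t = T q) := by
  have : CompleteSpace E := FiniteDimensional.complete ℝ E
  let F : E × ℝ → E × ℝ := fun p => (p.1, M p)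
  have hFO : ContDiffOn ℝ (⊤ : ℕ∞) F O := contDiffOn_fst.prodMk hM
  have hF : ∀ p ∈ O, ContDiffAt ℝ (⊤ : ℕ∞) F p := fun p hp =>
    hFO.contDiffAt (hO.mem_nhds hp)
  have hne : ((⊤ : ℕ∞) : WithTop ℕ∞) ≠ 0 := by simp
  have hinj : Function.Injective (fderiv ℝ F (x, t₀)) := by
    have hfd : HasFDerivAt F
        ((ContinuousLinearMap.fst ℝ E ℝ).prod (fderiv ℝ M (x, t₀))) (x, t₀) :=
      hasFDerivAt_fst.prodMk
        ((hM.contDiffAt (hO.mem_nhds hxO)).differentiableAt hne).hasFDerivAt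
    rw [hfd.fderiv, injective_iff_map_eq_zero]
    rintro ⟨v, s⟩ hvs
    obtain ⟨hv, hs⟩ := Prod.mk.inj hvs
    have hv : v = 0 := hv
    subst hv
    have hs : fderiv ℝ M (x, t₀) (0, s) = 0 := hs
    have h1 : ((0, s) : E × ℝ) = s • (0, 1) := by simp
    rw [h1, map_smul, smul_eq_mul] at hs
    rcases mul_eq_zero.1 hs with h | h
    · simp [h]
    · exact absurd h hd
  let e : (E × ℝ) ≃L[ℝ] (E × ℝ) :=
    (LinearEquiv.ofInjectiveEndo (fderiv ℝ F (x, t₀) : E × ℝ →ₗ[ℝ] E × ℝ)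
      hinj).toContinuousLinearEquiv
  have he : (e : E × ℝ →L[ℝ] E × ℝ) = fderiv ℝ F (x, t₀) := by
    ext1 <;> rfl
  have hder : HasFDerivAt F (e : E × ℝ →L[ℝ] E × ℝ) (x, t₀) := by
    rw [he]; exact ((hF _ hxO).differentiableAt hne).hasFDerivAt
  let G := (hF _ hxO).toOpenPartialHomeomorph F hder hne
  have hGs : (x, t₀) ∈ G.source := (hF _ hxO).mem_toOpenPartialHomeomorph_source hder hne
  have hGF : ∀ p, G p = F p := fun _ => rfl
  have hGx : G (x, t₀) = (x, 0) := by rw [hGF]; simp [F, h0]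
  have hGt : (x, (0 : ℝ)) ∈ G.target := hGx ▸ G.map_source hGs
  have hGsymm : G.symm (x, 0) = (x, t₀) := by rw [← hGx, G.left_inv hGs]
  have hinvert : ∀ᶠ p in 𝓝 (x, t₀), fderiv ℝ F p ∈
      range ((↑) : ((E × ℝ) ≃L[ℝ] (E × ℝ)) → (E × ℝ →L[ℝ] E × ℝ)) :=
    ((hFO.continuousOn_fderiv_of_isOpen hO (by simp)).continuousAt
      (hO.mem_nhds hxO)).eventually
      (ContinuousLinearEquiv.isOpen.mem_nhds ⟨e, he⟩)
  have hS : ∀ᶠ p in 𝓝 (x, t₀), p ∈ G.source := G.open_source.mem_nhds hGs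
  rw [nhds_prod_eq] at hS
  obtain ⟨A, hA, B, hB, hAB⟩ := eventually_prod_iff.1 hS
  obtain ⟨I, hIsub, hIo, hI⟩ := _root_.mem_nhds_iff.1 (inter_mem hB hJ)
  have hcx : ContinuousAt (fun q : E => (q, (0 : ℝ))) x := by fun_prop
  have hcG : Tendsto (fun q : E => G.symm (q, 0)) (𝓝 x) (𝓝 (x, t₀)) := by
    have := (G.continuousAt_symm hGt).tendsto.comp hcx
    rwa [hGsymm] at this
  have hev : ∀ᶠ q in 𝓝 x, (A q ∧ q ∈ W) ∧ (q, (0 : ℝ)) ∈ G.target ∧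
      (G.symm (q, 0)).2 ∈ I ∧ G.symm (q, 0) ∈ O ∧
      fderiv ℝ F (G.symm (q, 0)) ∈
        range ((↑) : ((E × ℝ) ≃L[ℝ] (E × ℝ)) → (E × ℝ →L[ℝ] E × ℝ)) :=
    (hA.and hW).and <| (hcx.eventually (G.open_target.mem_nhds hGt)).and <|
      ((hcG.snd_nhds).eventually (hIo.mem_nhds hI)).and <|
      (hcG.eventually (hO.mem_nhds hxO)).and (hcG.eventually hinvert)
  obtain ⟨U, hU, hUo, hxU⟩ := eventually_nhds_iff.1 hev
  refine ⟨U, hUo, hxU, fun q hq => (hU q hq).1.2, I, hIo, hI, fun t ht => (hIsub ht).2,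
    fun q => (G.symm (q, 0)).2, ?_, by simp [hGsymm], fun q hq => (hU q hq).2.2.1, ?_⟩
  · intro q hq
    obtain ⟨-, htq, -, hqO, e', he'⟩ := hU q hq
    have hsymm : ContDiffAt ℝ (⊤ : ℕ∞) G.symm (q, 0) :=
      G.contDiffAt_symm (f₀' := e') htq
        (by rw [he']; exact ((hF _ hqO).differentiableAt hne).hasFDerivAt) (hF _ hqO)
    exact (hsymm.comp q (f := fun q : E => (q, (0 : ℝ)))
      (contDiffAt_id.prodMk contDiffAt_const)).snd.contDiffWithinAt
  · intro q hq t ht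
    obtain ⟨⟨hAq, -⟩, htq, -⟩ := hU q hq
    have hqt : (q, t) ∈ G.source := hAB hAq (hIsub ht).1
    constructor
    · intro h
      have h2 : G (q, t) = (q, 0) := by rw [hGF]; simp [F, h]
      change t = (G.symm (q, 0)).2
      rw [← h2, G.left_inv hqt]
    · intro h
      have h2 : F (G.symm (q, 0)) = (q, 0) := G.right_inv htq
      obtain ⟨h3, h4⟩ := Prod.mk.inj h2
      have h5 : G.symm (q, 0) = (q, t) := Prod.ext h3 h.symm
      rwa [h5] at h4

theorem statement7
    (x : ℂ × ℂ) (hx : x ≠ 0)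
    (N : Set (ℂ × ℂ)) (hNopen : IsOpen N) (hxN : x ∈ N)
    (hNne0 : ∀ p ∈ N, p ≠ (0 : ℂ × ℂ))
    (V : ℂ × ℂ → ℂ × ℂ)
    (hVsmooth : ContDiffOn ℝ (⊤ : ℕ∞) V N)
    (hVne : ∀ p ∈ N, V p ≠ 0)
    (m : ℕ) (hm : 0 < m)
    (hinv : ∀ p ∈ N, ∃ c : ℂ,
      fderiv ℝ (fun q => Complex.I • V q) p (V p)
        - fderiv ℝ V p (Complex.I • V p) = c • V p)
    (hhom : ∀ p ∈ N, ∀ t : ℝ, t • p ∈ N → V (t • p) = (t ^ m : ℝ) • V p)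
    (htrans : ∀ p ∈ N, ∀ c : ℂ, p ≠ c • V p)
    -- Foliation-chart data
    (δ : ℝ) (hδ : δ ∈ Set.Ioo (0 : ℝ) 1)
    (φ u : ℂ × ℂ → ℂ)
    (hφ : ContDiffOn ℝ (⊤ : ℕ∞) φ N) (hu : ContDiffOn ℝ (⊤ : ℕ∞) u N)
    (hΦmaps : Set.MapsTo (fun p => (φ p, u p)) N
      (Metric.ball (0 : ℂ) 1 ×ˢ Metric.ball (0 : ℂ) 1))
    (hφx : φ x = 0) (hux : u x = 0)
    (Ψ : ℂ × ℂ → ℂ × ℂ)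
    (hΨ : ContDiffOn ℝ (⊤ : ℕ∞) Ψ (Metric.ball (0 : ℂ) 1 ×ˢ Metric.ball (0 : ℂ) 1))
    (hΨmaps : Set.MapsTo Ψ (Metric.ball (0 : ℂ) 1 ×ˢ Metric.ball (0 : ℂ) 1) N)
    (hleft : ∀ p ∈ N, Ψ (φ p, u p) = p)
    (hright : ∀ q ∈ Metric.ball (0 : ℂ) 1 ×ˢ Metric.ball (0 : ℂ) 1,
      (φ (Ψ q), u (Ψ q)) = q)
    (hker : ∀ p ∈ N, ∀ v : ℂ × ℂ, fderiv ℝ u p v = 0 ↔ ∃ c : ℂ, v = c • V p)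
    (hscale : ∀ t ∈ Set.Ioo (1 - δ) (1 + δ), ∀ a ∈ N, ∀ b ∈ N,
      t • a ∈ N → t • b ∈ N → u a = u b → u (t • a) = u (t • b))
    -- Ω and ω = (ω₁, ω₂)
    (Ω : Set ℂ) (hΩopen : IsOpen Ω) (h0Ω : (0 : ℂ) ∈ Ω)
    (hΩsub : Ω ⊆ Metric.ball (0 : ℂ) 1)
    (ω₁ ω₂ : ℂ → ℝ)
    (hω : ContDiffOn ℝ (⊤ : ℕ∞) (fun τ => (ω₁ τ, ω₂ τ)) Ω)
    (hωmaps : Set.MapsTo (fun τ => (ω₁ τ, ω₂ τ)) Ω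
      (Set.Ioo (-1 : ℝ) 1 ×ˢ Set.Ioo (-1 : ℝ) 1))
    (ψ : ℝ × ℝ → ℂ)
    (hψ : ContDiffOn ℝ (⊤ : ℕ∞) ψ (Set.Ioo (-1 : ℝ) 1 ×ˢ Set.Ioo (-1 : ℝ) 1))
    (hψmaps : Set.MapsTo ψ (Set.Ioo (-1 : ℝ) 1 ×ˢ Set.Ioo (-1 : ℝ) 1) Ω)
    (hωleft : ∀ τ ∈ Ω, ψ (ω₁ τ, ω₂ τ) = τ)
    (hωright : ∀ q ∈ Set.Ioo (-1 : ℝ) 1 ×ˢ Set.Ioo (-1 : ℝ) 1,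
      (ω₁ (ψ q), ω₂ (ψ q)) = q)
    (hω₂ne : ∀ τ ∈ Ω, fderiv ℝ ω₂ τ ≠ 0)
    (horth : ∀ τ ∈ Ω, fderiv ℝ ω₂ τ (fderiv ℝ u (Ψ (0, τ)) (Ψ (0, τ))) = 0)
    -- The shell W_x
    (W_x : Set (ℂ × ℂ)) (hWopen : IsOpen W_x) (hxW : x ∈ W_x) (hWN : W_x ⊆ N)
    (hWΩ : ∀ p ∈ W_x, u p ∈ Ω)
    (hWsym : ∀ p ∈ W_x, -p ∉ W_x)
    (hWcpt : IsCompact (closure (u '' W_x)) ∧ closure (u '' W_x) ⊆ Ω)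
    (B_x : Set (ℂ × ℂ))
    (hBsph : B_x ⊆ {p : ℂ × ℂ | ‖p.1‖ ^ 2 + ‖p.2‖ ^ 2 = ‖x.1‖ ^ 2 + ‖x.2‖ ^ 2})
    (hBopen : ∃ U : Set (ℂ × ℂ), IsOpen U ∧
      B_x = U ∩ {p : ℂ × ℂ | ‖p.1‖ ^ 2 + ‖p.2‖ ^ 2 = ‖x.1‖ ^ 2 + ‖x.2‖ ^ 2})
    (hxB : x ∈ B_x)
    (d_x : ℝ) (hd : d_x ∈ Set.Ioo (0 : ℝ) 1)
    (hWeq : W_x = {q : ℂ × ℂ | ∃ t ∈ Set.Ioo (1 - d_x) (1 + d_x), ∃ p ∈ B_x, q = t • p})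
    (hshell : ∀ q ∈ W_x, ∀ t : ℝ,
      (1 - d_x) / (1 + d_x) < t → t < (1 + d_x) / (1 - d_x) →
      t • q ∈ N ∧ u (t • q) ∈ Ω)
    -- ω₂ ∘ u is constant along rays in W_x
    (hray : ∀ p₁ ∈ W_x, ∀ p₂ ∈ W_x, (∃ s : ℝ, 0 < s ∧ p₂ = s • p₁) →
      ω₂ (u p₁) = ω₂ (u p₂))
    -- W̃_x and δ̃_x
    (W'_x : Set (ℂ × ℂ)) (hW'open : IsOpen W'_x) (hxW' : x ∈ W'_x)
    (hW'cpt : IsCompact (closure W'_x)) (hW'sub : closure W'_x ⊆ W_x)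
    (δ' : ℝ) (hδ' : δ' ∈ Set.Ioo (0 : ℝ) δ)
    (hδ'scale : ∀ q ∈ W'_x, ∀ t ∈ Set.Ioo (1 - δ') (1 + δ'), t • q ∈ W_x) :
    deriv (fun t : ℝ => ω₁ (u (t • x)) - ω₁ (u x)) 1 ≠ 0 ∧
    ∃ V_x : Set (ℂ × ℂ), IsOpen V_x ∧ x ∈ V_x ∧ V_x ⊆ W'_x ∧
      ∃ I : Set ℝ, IsOpen I ∧ (1 : ℝ) ∈ I ∧ I ⊆ Set.Ioo (1 - δ') (1 + δ') ∧
        ∃ T : ℂ × ℂ → ℝ, ContDiffOn ℝ (⊤ : ℕ∞) T V_x ∧ T x = 1 ∧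
          Set.MapsTo T V_x I ∧
          ∀ q ∈ V_x, ∀ t ∈ I, (ω₁ (u (t • q)) - ω₁ (u x) = 0 ↔ t = T q) := by
  have hne : ((⊤ : ℕ∞) : WithTop ℕ∞) ≠ 0 := by simp
  have hone : (1 : ℝ) ∈ Set.Ioo (1 - δ') (1 + δ') := ⟨by linarith [hδ'.1], by linarith [hδ'.1]⟩
  have huAt : HasFDerivAt u (fderiv ℝ u x) x :=
    ((hu.contDiffAt (hNopen.mem_nhds hxN)).differentiableAt hne).hasFDerivAt
  have hux_ne : fderiv ℝ u x x ≠ 0 := fun h => by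
    obtain ⟨c, hc⟩ := (hker x hxN x).1 h
    exact htrans x hxN c hc
  have hω₁ : ContDiffOn ℝ (⊤ : ℕ∞) ω₁ Ω := hω.fst
  have hω₂ : ContDiffOn ℝ (⊤ : ℕ∞) ω₂ Ω := hω.snd
  have hΩ0 : Ω ∈ nhds (u x) := hΩopen.mem_nhds (hux ▸ h0Ω)
  have hω₁At : HasFDerivAt ω₁ (fderiv ℝ ω₁ (u x)) (u x) :=
    ((hω₁.contDiffAt hΩ0).differentiableAt hne).hasFDerivAt
  have hω₂At : HasFDerivAt ω₂ (fderiv ℝ ω₂ (u x)) (u x) :=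
    ((hω₂.contDiffAt hΩ0).differentiableAt hne).hasFDerivAt
  have hω₂zero : fderiv ℝ ω₂ (u x) (fderiv ℝ u x x) = 0 := by
    have hΨx : Ψ (0, 0) = x := by simpa [hφx, hux] using hleft x hxN
    simpa [hΨx, hux] using horth 0 h0Ω
  have hω₁ne : fderiv ℝ ω₁ (u x) (fderiv ℝ u x x) ≠ 0 := by
    intro h
    have hψAt : DifferentiableAt ℝ ψ (ω₁ (u x), ω₂ (u x)) :=
      (hψ.contDiffAt ((isOpen_Ioo.prod isOpen_Ioo).mem_nhds
        (hωmaps (mem_of_mem_nhds hΩ0)))).differentiableAt hne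
    have hcomp := hψAt.hasFDerivAt.comp (u x) (hω₁At.prodMk hω₂At)
    have hid : HasFDerivAt (ψ ∘ fun τ => (ω₁ τ, ω₂ τ)) (ContinuousLinearMap.id ℝ ℂ) (u x) :=
      (hasFDerivAt_id (u x)).congr_of_eventuallyEq
        (Filter.eventually_of_mem hΩ0 fun τ hτ => hωleft τ hτ)
    have happ := congrArg (fun L : ℂ →L[ℝ] ℂ => L (fderiv ℝ u x x)) (hcomp.unique hid)
    simp only [ContinuousLinearMap.comp_apply, ContinuousLinearMap.prod_apply, h, hω₂zero,
      ContinuousLinearMap.id_apply] at happ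
    exact hux_ne (happ.symm.trans (map_zero _))
  let M : (ℂ × ℂ) × ℝ → ℝ := fun p => ω₁ (u (p.2 • p.1)) - ω₁ (u x)
  let O : Set ((ℂ × ℂ) × ℝ) := (fun p => p.2 • p.1) ⁻¹' W_x
  have hO : IsOpen O := hWopen.preimage (continuous_snd.smul continuous_fst)
  have hxO : (x, (1 : ℝ)) ∈ O := by simpa [O] using hxW
  have hM : ContDiffOn ℝ (⊤ : ℕ∞) M O :=
    (hω₁.comp (hu.comp (contDiff_snd.smul contDiff_fst).contDiffOn
      fun p hp => hWN hp) fun p hp => hWΩ _ hp).sub contDiffOn_const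
  have hline : HasDerivAt (fun t : ℝ => M (x, t)) (fderiv ℝ M (x, 1) (0, 1)) 1 :=
    ((hM.contDiffAt (hO.mem_nhds hxO)).differentiableAt hne).hasFDerivAt.comp_hasDerivAt 1
      ((hasDerivAt_const (1 : ℝ) x).prodMk (hasDerivAt_id 1))
  have hray' : HasDerivAt (fun t : ℝ => M (x, t)) (fderiv ℝ ω₁ (u x) (fderiv ℝ u x x)) 1 := by
    have hsmul : HasDerivAt (fun t : ℝ => t • x) x 1 := by
      simpa using (hasDerivAt_id (1 : ℝ)).smul_const x
    have hu1 : HasFDerivAt u (fderiv ℝ u x) ((1 : ℝ) • x) := by rwa [one_smul]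
    have hω1 : HasFDerivAt ω₁ (fderiv ℝ ω₁ (u x)) (u ((1 : ℝ) • x)) := by rwa [one_smul]
    exact (hω1.comp_hasDerivAt 1 (hu1.comp_hasDerivAt 1 hsmul)).sub_const _
  refine ⟨hray'.deriv.trans_ne hω₁ne, ?_⟩
  exact exists_contDiffOn_implicit_scalar hO hM hxO (by simp [M])
    (hline.unique hray' ▸ hω₁ne) (hW'open.mem_nhds hxW') (isOpen_Ioo.mem_nhds hone)
end

section
/- Assume the Setup and that u : N → ℂ is a smooth map such that, for every p ∈ N, the kernel of the real Fréchet derivative of u at p equals span_ℂ{𝒱(p)}. Let q ∈ ℂ²∖{0}, let λ ∈ (0,1), and let T : (1−λ, 1+λ) → (0, ∞) be a smooth function such that s·T(s)·q ∈ N for all s ∈ (1−λ, 1+λ) and such that the map s ↦ u(s·T(s)·q) is constant on (1−λ, 1+λ). Then the map s ↦ s·T(s) is constant on (1−λ, 1+λ). (This is the key step showing that g(q) := 𝒯(q)^{−n} is ℝ-homogeneous of degree n.) -/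
/-!
STATEMENT 9: Under the Setup, let u : N → ℂ be smooth with
ker(Du(p)) = span_ℂ{𝒱(p)} for every p ∈ N. Let q ∈ ℂ²∖{0}, λ ∈ (0,1) and
T : (1−λ, 1+λ) → (0,∞) smooth with s·T(s)·q ∈ N for all s ∈ (1−λ, 1+λ) and
s ↦ u(s·T(s)·q) constant on (1−λ, 1+λ). Then s ↦ s·T(s) is constant on
(1−λ, 1+λ).
-/

theorem statement9
    (x : ℂ × ℂ) (hx : x ≠ 0)
    (N : Set (ℂ × ℂ)) (hNopen : IsOpen N) (hxN : x ∈ N)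
    (hNne0 : ∀ p ∈ N, p ≠ (0 : ℂ × ℂ))
    (V : ℂ × ℂ → ℂ × ℂ)
    (hVsmooth : ContDiffOn ℝ (⊤ : ℕ∞) V N)
    (hVne : ∀ p ∈ N, V p ≠ 0)
    (m : ℕ) (hm : 0 < m)
    (hinv : ∀ p ∈ N, ∃ c : ℂ,
      fderiv ℝ (fun q => Complex.I • V q) p (V p)
        - fderiv ℝ V p (Complex.I • V p) = c • V p)
    (hhom : ∀ p ∈ N, ∀ t : ℝ, t • p ∈ N → V (t • p) = (t ^ m : ℝ) • V p)
    (htrans : ∀ p ∈ N, ∀ c : ℂ, p ≠ c • V p)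
    (u : ℂ × ℂ → ℂ)
    (hu : ContDiffOn ℝ (⊤ : ℕ∞) u N)
    (hker : ∀ p ∈ N, ∀ v : ℂ × ℂ, fderiv ℝ u p v = 0 ↔ ∃ c : ℂ, v = c • V p)
    (q : ℂ × ℂ) (hq : q ≠ 0)
    (lam : ℝ) (hlam : lam ∈ Set.Ioo (0 : ℝ) 1)
    (T : ℝ → ℝ)
    (hT : ContDiffOn ℝ (⊤ : ℕ∞) T (Set.Ioo (1 - lam) (1 + lam)))
    (hTpos : ∀ s ∈ Set.Ioo (1 - lam) (1 + lam), 0 < T s)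
    (hmem : ∀ s ∈ Set.Ioo (1 - lam) (1 + lam), (s * T s) • q ∈ N)
    (hconst : ∀ s₁ ∈ Set.Ioo (1 - lam) (1 + lam), ∀ s₂ ∈ Set.Ioo (1 - lam) (1 + lam),
      u ((s₁ * T s₁) • q) = u ((s₂ * T s₂) • q)) :
    ∀ s₁ ∈ Set.Ioo (1 - lam) (1 + lam), ∀ s₂ ∈ Set.Ioo (1 - lam) (1 + lam),
      s₁ * T s₁ = s₂ * T s₂ := by
  have hopen : IsOpen (Set.Ioo (1 - lam) (1 + lam)) := isOpen_Ioo
  have hTdiff : DifferentiableOn ℝ T (Set.Ioo (1 - lam) (1 + lam)) := hT.differentiableOn (by simp)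
  have hdiff : DifferentiableOn ℝ (fun s => s * T s) (Set.Ioo (1 - lam) (1 + lam)) :=
    differentiableOn_id.mul hTdiff
  have hderiv : Set.EqOn (deriv fun s => s * T s) 0 (Set.Ioo (1 - lam) (1 + lam)) := by
    intro s hs
    by_contra hne
    change deriv (fun s => s * T s) s ≠ 0 at hne
    have hf : HasDerivAt (fun s => s * T s) (deriv (fun s => s * T s) s) s :=
      (hdiff.differentiableAt (hopen.mem_nhds hs)).hasDerivAt
    have hu' : HasFDerivAt u (fderiv ℝ u ((s * T s) • q)) ((s * T s) • q) :=
      ((hu.differentiableOn (by simp)).differentiableAt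
        (hNopen.mem_nhds (hmem s hs))).hasFDerivAt
    have hcomp : HasDerivAt (fun s => u ((s * T s) • q))
        (fderiv ℝ u ((s * T s) • q) (deriv (fun s => s * T s) s • q)) s :=
      hu'.comp_hasDerivAt s (hf.smul_const q)
    have hloc : (fun s => u ((s * T s) • q)) =ᶠ[nhds s] fun _ => u ((s * T s) • q) := by
      filter_upwards [hopen.mem_nhds hs] with r hr using hconst r hr s hs
    obtain ⟨c, hc⟩ := (hker _ (hmem s hs) _).1
      (hcomp.unique ((hasDerivAt_const s _).congr_of_eventuallyEq hloc))
    set d : ℝ := deriv (fun s => s * T s) s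
    refine htrans _ (hmem s hs) (((s * T s * d⁻¹ : ℝ) : ℂ) * c) ?_
    rw [SemigroupAction.mul_smul _ c, ← hc, Complex.coe_smul, smul_smul, inv_mul_cancel_right₀ hne]
  intro s₁ h₁ s₂ h₂
  exact hopen.is_const_of_deriv_eq_zero isPreconnected_Ioo hdiff hderiv h₁ h₂
end

section
/- Let P : ℂ² → ℝ be a real-valued polynomial in the complex variables (z,w) and their conjugates (z̄,w̄) whose Levi determinant vanishes identically, i.e. det H_P ≡ 0 on ℂ². Define the vector field 𝒱 : ℂ² → ℂ² by 𝒱 := (−∂²P/∂w∂z̄, ∂²P/∂z∂z̄). Then at every point p ∈ ℂ² one has H_P(p)·𝒱(p) = 0, and at every point p with 𝒱(p) ≠ 0 the Lie bracket [𝒱, i·𝒱](p) lies in span_ℂ{𝒱(p)} (so on the open set where 𝒱 does not vanish, the complex lines spanned by 𝒱 form an involutive rank-2 real distribution, whose integral surfaces are complex curves along which P is harmonic). -/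
/-!
STATEMENT 10: Let P : ℂ² → ℝ be a real-valued polynomial in (z,w,z̄,w̄) with
complex coefficients whose Levi determinant vanishes identically. For
𝒱 := (−∂²P/∂w∂z̄, ∂²P/∂z∂z̄) one has H_P(p)·𝒱(p) = 0 at every p ∈ ℂ², and at
every p with 𝒱(p) ≠ 0 the Lie bracket [𝒱, i𝒱](p) lies in span_ℂ{𝒱(p)}.
-/

/-- Wirtinger derivative ∂f/∂z on ℂ², computed from the real Fréchet derivative. -/
noncomputable def wdz (f : ℂ × ℂ → ℂ) (p : ℂ × ℂ) : ℂ :=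
  (1 / 2 : ℂ) * (fderiv ℝ f p (1, 0) - Complex.I * fderiv ℝ f p (Complex.I, 0))

/-- Wirtinger derivative ∂f/∂z̄ on ℂ². -/
noncomputable def wdzbar (f : ℂ × ℂ → ℂ) (p : ℂ × ℂ) : ℂ :=
  (1 / 2 : ℂ) * (fderiv ℝ f p (1, 0) + Complex.I * fderiv ℝ f p (Complex.I, 0))

/-- Wirtinger derivative ∂f/∂w on ℂ². -/
noncomputable def wdw (f : ℂ × ℂ → ℂ) (p : ℂ × ℂ) : ℂ :=
  (1 / 2 : ℂ) * (fderiv ℝ f p (0, 1) - Complex.I * fderiv ℝ f p (0, Complex.I))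

/-- Wirtinger derivative ∂f/∂w̄ on ℂ². -/
noncomputable def wdwbar (f : ℂ × ℂ → ℂ) (p : ℂ × ℂ) : ℂ :=
  (1 / 2 : ℂ) * (fderiv ℝ f p (0, 1) + Complex.I * fderiv ℝ f p (0, Complex.I))

/-- The complex Hessian (Levi) matrix of P : ℂ² → ℝ, with rows
(∂²P/∂z∂z̄, ∂²P/∂w∂z̄) and (∂²P/∂z∂w̄, ∂²P/∂w∂w̄). -/
noncomputable def leviMatrix (P : ℂ × ℂ → ℝ) (p : ℂ × ℂ) : Matrix (Fin 2) (Fin 2) ℂ :=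
  !![wdz (wdzbar fun q => (P q : ℂ)) p, wdw (wdzbar fun q => (P q : ℂ)) p;
     wdz (wdwbar fun q => (P q : ℂ)) p, wdw (wdwbar fun q => (P q : ℂ)) p]

/-- P is a real-valued polynomial with complex coefficients in z, w, z̄, w̄. -/
def IsPolyCZW (P : ℂ × ℂ → ℝ) : Prop :=
  ∃ Q : MvPolynomial (Fin 4) ℂ, ∀ p : ℂ × ℂ,
    (P p : ℂ) = MvPolynomial.eval ![p.1, p.2, (starRingEnd ℂ) p.1, (starRingEnd ℂ) p.2] Q

/-- The vector field 𝒱 = (−∂²P/∂w∂z̄, ∂²P/∂z∂z̄) associated to P. -/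
noncomputable def leviKernelField (P : ℂ × ℂ → ℝ) (p : ℂ × ℂ) : ℂ × ℂ :=
  (-(wdw (wdzbar fun q => (P q : ℂ)) p), wdz (wdzbar fun q => (P q : ℂ)) p)

open scoped ContDiff

/-- The first-order operator `f ↦ (∂ᵤ f + ε ∂ᵥ f) / 2`, of which the Wirtinger derivatives are
special cases. -/
noncomputable def wirtinger (ε : ℂ) (u v : ℂ × ℂ) (f : ℂ × ℂ → ℂ) (p : ℂ × ℂ) : ℂ :=
  (1 / 2 : ℂ) * (fderiv ℝ f p u + ε * fderiv ℝ f p v)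

lemma wdz_eq_wirtinger : wdz = wirtinger (-Complex.I) (1, 0) (Complex.I, 0) := by
  funext f p
  simp only [wdz, wirtinger]
  ring

lemma wdzbar_eq_wirtinger : wdzbar = wirtinger Complex.I (1, 0) (Complex.I, 0) := rfl

lemma wdw_eq_wirtinger : wdw = wirtinger (-Complex.I) (0, 1) (0, Complex.I) := by
  funext f p
  simp only [wdw, wirtinger]
  ring

lemma wdwbar_eq_wirtinger : wdwbar = wirtinger Complex.I (0, 1) (0, Complex.I) := rfl

lemma ContDiff.fderiv_apply_const {f : ℂ × ℂ → ℂ} (hf : ContDiff ℝ ∞ f) (u : ℂ × ℂ) :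
    ContDiff ℝ ∞ (fun p => fderiv ℝ f p u) :=
  (hf.fderiv_right (m := ∞) (by simp)).clm_apply contDiff_const

lemma ContDiff.wirtinger {f : ℂ × ℂ → ℂ} (hf : ContDiff ℝ ∞ f) (ε : ℂ) (u v : ℂ × ℂ) :
    ContDiff ℝ ∞ (wirtinger ε u v f) :=
  contDiff_const.mul
    ((hf.fderiv_apply_const u).add (contDiff_const.mul (hf.fderiv_apply_const v)))

lemma ContDiff.fderiv_fderiv_comm {f : ℂ × ℂ → ℂ} (hf : ContDiff ℝ ∞ f) (p u v : ℂ × ℂ) :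
    fderiv ℝ (fun q => fderiv ℝ f q u) p v = fderiv ℝ (fun q => fderiv ℝ f q v) p u := by
  have hd : DifferentiableAt ℝ (fderiv ℝ f) p :=
    (hf.fderiv_right (m := ∞) (by simp)).differentiable (by simp) p
  have hs : IsSymmSndFDerivAt ℝ f p := hf.contDiffAt.isSymmSndFDerivAt (by
    rw [minSmoothness_of_isRCLikeNormedField]
    exact WithTop.coe_le_coe.2 (le_top : (2 : ℕ∞) ≤ ⊤))
  rw [fderiv_clm_apply hd (differentiableAt_const u), fderiv_clm_apply hd (differentiableAt_const v)]
  simpa using hs v u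

lemma fderiv_wirtinger {f : ℂ × ℂ → ℂ} (hf : ContDiff ℝ ∞ f) (ε : ℂ) (u v p x : ℂ × ℂ) :
    fderiv ℝ (wirtinger ε u v f) p x = (1 / 2 : ℂ) *
      (fderiv ℝ (fun q => fderiv ℝ f q u) p x + ε * fderiv ℝ (fun q => fderiv ℝ f q v) p x) := by
  have hu := (hf.fderiv_apply_const u).differentiable (by simp) p
  have hv := (hf.fderiv_apply_const v).differentiable (by simp) p
  have h := ((hu.hasFDerivAt.add (hv.hasFDerivAt.const_mul ε)).const_mul (1 / 2 : ℂ)).fderiv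
  refine (congrArg (fun L => L x) h).trans ?_
  simp [mul_add]

lemma wirtinger_comm {f : ℂ × ℂ → ℂ} (hf : ContDiff ℝ ∞ f) (ε δ : ℂ) (u v x y : ℂ × ℂ) :
    wirtinger ε u v (wirtinger δ x y f) = wirtinger δ x y (wirtinger ε u v f) := by
  funext p
  rw [wirtinger, wirtinger]
  simp only [fderiv_wirtinger hf]
  rw [hf.fderiv_fderiv_comm p u x, hf.fderiv_fderiv_comm p u y, hf.fderiv_fderiv_comm p v x,
    hf.fderiv_fderiv_comm p v y]
  ring

lemma conj_wirtinger {f : ℂ × ℂ → ℂ} (hf : ContDiff ℝ ∞ f) (ε : ℂ) (u v p : ℂ × ℂ) :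
    (starRingEnd ℂ) (wirtinger ε u v f p) =
      wirtinger ((starRingEnd ℂ) ε) u v (fun q => (starRingEnd ℂ) (f q)) p := by
  have h := (Complex.conjCLE.toContinuousLinearMap.hasFDerivAt.comp p
    (hf.differentiable (by simp) p).hasFDerivAt).fderiv
  have h' : fderiv ℝ (fun q => (starRingEnd ℂ) (f q)) p =
    Complex.conjCLE.toContinuousLinearMap.comp (fderiv ℝ f p) := h
  simp [wirtinger, h', Complex.conj_ofNat]

lemma wirtinger_mul {f g : ℂ × ℂ → ℂ} (hf : ContDiff ℝ ∞ f) (hg : ContDiff ℝ ∞ g) (ε : ℂ)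
    (u v p : ℂ × ℂ) :
    wirtinger ε u v (fun q => f q * g q) p =
      f p * wirtinger ε u v g p + g p * wirtinger ε u v f p := by
  have h : fderiv ℝ (fun q => f q * g q) p = _ :=
    fderiv_fun_mul (hf.differentiable (by simp) p) (hg.differentiable (by simp) p)
  simp only [wirtinger, h, add_apply, smul_apply,
    smul_eq_mul]
  ring

lemma fderiv_apply_eq_wirtinger (f : ℂ × ℂ → ℂ) (p v : ℂ × ℂ) :
    fderiv ℝ f p v = wdz f p * v.1 + wdzbar f p * (starRingEnd ℂ) v.1 +
      wdw f p * v.2 + wdwbar f p * (starRingEnd ℂ) v.2 := by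
  obtain ⟨x, y⟩ := v
  have hv : ((x, y) : ℂ × ℂ) = x.re • ((1, 0) : ℂ × ℂ) + x.im • ((Complex.I, 0) : ℂ × ℂ) +
      y.re • ((0, 1) : ℂ × ℂ) + y.im • ((0, Complex.I) : ℂ × ℂ) := by
    simp
  have hL := congrArg (fderiv ℝ f p) hv
  simp only [map_add, map_smul, Complex.real_smul] at hL
  rw [hL]
  simp only [wdz, wdzbar, wdw, wdwbar]
  conv_rhs => rw [← Complex.re_add_im x, ← Complex.re_add_im y]
  simp only [map_add, map_mul, Complex.conj_ofReal, Complex.conj_I]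
  linear_combination (fderiv ℝ f p (Complex.I, 0) * x.im + fderiv ℝ f p (0, Complex.I) * y.im) *
    Complex.I_sq

lemma IsPolyCZW.contDiff {P : ℂ × ℂ → ℝ} (h : IsPolyCZW P) :
    ContDiff ℝ ∞ (fun p => (P p : ℂ)) := by
  obtain ⟨Q, hQ⟩ := h
  rw [funext hQ]
  clear hQ
  induction Q using MvPolynomial.induction_on with
  | C a => simpa using contDiff_const
  | add p q hp hq => simpa using hp.add hq
  | mul_X p i hp =>
    simp only [map_mul, MvPolynomial.eval_X]
    refine hp.mul ?_
    fin_cases i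
    · exact contDiff_fst
    · exact contDiff_snd
    · exact Complex.conjCLE.contDiff.comp contDiff_fst
    · exact Complex.conjCLE.contDiff.comp contDiff_snd

/-- The bracket `[V, iV]` only sees the antiholomorphic part of the derivative of `V`. -/
lemma smul_I_bracket_eq {f g : ℂ × ℂ → ℂ} (hf : ContDiff ℝ ∞ f) (hg : ContDiff ℝ ∞ g)
    (p v : ℂ × ℂ) :
    fderiv ℝ (fun q => Complex.I • (f q, g q)) p v
        - fderiv ℝ (fun q => (f q, g q)) p (Complex.I • v) =
      (2 * Complex.I) • (wdzbar f p * (starRingEnd ℂ) v.1 + wdwbar f p * (starRingEnd ℂ) v.2,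
        wdzbar g p * (starRingEnd ℂ) v.1 + wdwbar g p * (starRingEnd ℂ) v.2) := by
  have hf' := hf.differentiable (by simp) p
  have hg' := hg.differentiable (by simp) p
  rw [fderiv_fun_const_smul (hf'.prodMk hg'), hf'.fderiv_prodMk hg']
  ext <;>
  · simp [fderiv_apply_eq_wirtinger _ p]
    ring

theorem statement10
    (P : ℂ × ℂ → ℝ) (hpoly : IsPolyCZW P)
    (hdet : ∀ p : ℂ × ℂ, (leviMatrix P p).det = 0) :
    (∀ p : ℂ × ℂ,
      (leviMatrix P p).mulVec ![(leviKernelField P p).1, (leviKernelField P p).2] = 0) ∧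
    (∀ p : ℂ × ℂ, leviKernelField P p ≠ 0 → ∃ c : ℂ,
      fderiv ℝ (fun q => Complex.I • leviKernelField P q) p (leviKernelField P p)
        - fderiv ℝ (leviKernelField P) p (Complex.I • leviKernelField P p)
        = c • leviKernelField P p) := by
  have hF : ContDiff ℝ ∞ (fun p => (P p : ℂ)) := hpoly.contDiff
  set F : ℂ × ℂ → ℂ := fun p => (P p : ℂ) with hFdef
  have hFconj : (fun q => (starRingEnd ℂ) (F q)) = F := by
    funext q
    simp [hFdef]
  obtain ⟨a, ha⟩ : ∃ a, a = wdz (wdzbar F) := ⟨_, rfl⟩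
  obtain ⟨b, hb⟩ : ∃ b, b = wdw (wdzbar F) := ⟨_, rfl⟩
  obtain ⟨c, hc⟩ : ∃ c, c = wdz (wdwbar F) := ⟨_, rfl⟩
  obtain ⟨d, hd⟩ : ∃ d, d = wdw (wdwbar F) := ⟨_, rfl⟩
  have hM : ∀ p, leviMatrix P p = !![a p, b p; c p, d p] := by
    intro p
    rw [ha, hb, hc, hd]
    rfl
  have hV : leviKernelField P = fun p => (-b p, a p) := by
    rw [ha, hb]
    rfl
  have hdet' : ∀ p, a p * d p = b p * c p := fun p => by
    have h := hdet p
    rw [hM, Matrix.det_fin_two_of] at h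
    exact sub_eq_zero.mp h
  simp only [wdz_eq_wirtinger, wdzbar_eq_wirtinger, wdw_eq_wirtinger, wdwbar_eq_wirtinger]
    at ha hb hc hd
  have has : ContDiff ℝ ∞ a := ha ▸ (hF.wirtinger _ _ _).wirtinger _ _ _
  have hbs : ContDiff ℝ ∞ b := hb ▸ (hF.wirtinger _ _ _).wirtinger _ _ _
  have hcs : ContDiff ℝ ∞ c := hc ▸ (hF.wirtinger _ _ _).wirtinger _ _ _
  have hds : ContDiff ℝ ∞ d := hd ▸ (hF.wirtinger _ _ _).wirtinger _ _ _
  have conj_second : ∀ (ε δ : ℂ) (u v x y p : ℂ × ℂ),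
      (starRingEnd ℂ) (wirtinger ε u v (wirtinger δ x y F) p) =
        wirtinger ((starRingEnd ℂ) ε) u v (wirtinger ((starRingEnd ℂ) δ) x y F) p := by
    intro ε δ u v x y p
    rw [conj_wirtinger (hF.wirtinger _ _ _)]
    congr 1
    funext q
    rw [conj_wirtinger hF, hFconj]
  have hconj_a : ∀ p, (starRingEnd ℂ) (a p) = a p := fun p => by
    rw [ha, conj_second, wirtinger_comm hF]
    simp
  have hconj_b : ∀ p, (starRingEnd ℂ) (b p) = c p := fun p => by
    rw [hb, hc, conj_second, wirtinger_comm hF]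
    simp
  refine ⟨fun p => ?_, fun p hp => ?_⟩
  · rw [hM, hV]
    ext i
    fin_cases i
    · simp
      ring
    · simp
      linear_combination hdet' p
  · have hap : a p ≠ 0 := by
      intro h0
      have h := hdet' p
      rw [h0, zero_mul, ← hconj_b, Complex.mul_conj, eq_comm, Complex.ofReal_eq_zero,
        Complex.normSq_eq_zero] at h
      exact hp (by simp [hV, h, h0])
    have hac : wdwbar a p = wdzbar c p := by
      rw [wdwbar_eq_wirtinger, wdzbar_eq_wirtinger, ha, hc,
        wirtinger_comm (hF.wirtinger _ _ _) Complex.I, wirtinger_comm hF Complex.I Complex.I,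
        wirtinger_comm (hF.wirtinger _ _ _) Complex.I]
    have hbd : wdwbar b p = wdzbar d p := by
      rw [wdwbar_eq_wirtinger, wdzbar_eq_wirtinger, hb, hd,
        wirtinger_comm (hF.wirtinger _ _ _) Complex.I, wirtinger_comm hF Complex.I Complex.I,
        wirtinger_comm (hF.wirtinger _ _ _) Complex.I]
    have hdiff : a p * wdzbar d p + d p * wdzbar a p = b p * wdzbar c p + c p * wdzbar b p := by
      rw [wdzbar_eq_wirtinger, ← wirtinger_mul has hds, ← wirtinger_mul hbs hcs, funext hdet']
    have hneg : ∀ ε u v, wirtinger ε u v (fun q => -b q) p = -wirtinger ε u v b p := by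
      intro ε u v
      simp only [wirtinger, fderiv_fun_neg, neg_apply]
      ring
    refine ⟨2 * Complex.I * (-c p * wdzbar a p + a p * wdwbar a p) / a p, ?_⟩
    rw [hV, smul_I_bracket_eq hbs.neg has]
    have hnz : wdzbar (fun q => -b q) p = -wdzbar b p := hneg _ _ _
    have hnw : wdwbar (fun q => -b q) p = -wdwbar b p := hneg _ _ _
    simp only [hnz, hnw, map_neg, hconj_a, hconj_b, hac, hbd, Prod.smul_mk, smul_eq_mul]
    ext
    · field_simp
      linear_combination (-(a p)) * hdiff + wdzbar a p * hdet' p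
    · field_simp
end
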